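/- Suppose 𝕂 is a computable age with HP, JEP, and AP. Then 𝕂 has an EmbedInfo(𝕂)-computable Fraïssé limit, i.e., an EmbedInfo(𝕂)-computable structure that is EmbedInfo(𝕂)-computably ultrahomogeneous and whose age is represented by 𝕂. -/

import Mathlib

/- Self-contained framework for computable ages and cofinal Fraïssé limits. -/

namespace CFL

open Classical

/-! ### Oracle computability -/

/-- The characteristic partial function of a set of naturals. -/
noncomputable def chi (A : Set ℕ) : ℕ →. ℕ :=
  fun n => Part.some (if n ∈ A then 1 else 0)

/-- Codes for oracle partial recursive functions. -/
inductive OCode : Type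
  | zero : OCode
  | succ : OCode
  | left : OCode
  | right : OCode
  | oracle : OCode
  | pair : OCode → OCode → OCode
  | comp : OCode → OCode → OCode
  | prec : OCode → OCode → OCode
  | rfind' : OCode → OCode

/-- Evaluation of an oracle code relative to an oracle `O`. -/
def OCode.eval (O : ℕ →. ℕ) : OCode → ℕ →. ℕ
  | OCode.zero => pure 0
  | OCode.succ => Nat.succ
  | OCode.left => ↑fun n : ℕ => n.unpair.1
  | OCode.right => ↑fun n : ℕ => n.unpair.2
  | OCode.oracle => O
  | OCode.pair cf cg => fun n => Nat.pair <$> OCode.eval O cf n <*> OCode.eval O cg n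
  | OCode.comp cf cg => fun n => OCode.eval O cg n >>= OCode.eval O cf
  | OCode.prec cf cg =>
    Nat.unpaired fun a n =>
      n.rec (OCode.eval O cf a) fun y IH => do
        let i ← IH
        OCode.eval O cg (Nat.pair a (Nat.pair y i))
  | OCode.rfind' cf =>
    Nat.unpaired fun a m =>
      (Nat.rfind fun n => (fun m => m = 0) <$> OCode.eval O cf (Nat.pair a (n + m))).map
        (· + m)

/-- A numerical code of an `OCode`. -/
def OCode.encodeCode : OCode → ℕ
  | OCode.zero => 0
  | OCode.succ => 1
  | OCode.left => 2
  | OCode.right => 3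
  | OCode.oracle => 4
  | OCode.pair cf cg => 4 * Nat.pair cf.encodeCode cg.encodeCode + 5
  | OCode.comp cf cg => 4 * Nat.pair cf.encodeCode cg.encodeCode + 6
  | OCode.prec cf cg => 4 * Nat.pair cf.encodeCode cg.encodeCode + 7
  | OCode.rfind' cf => 4 * cf.encodeCode + 8

/-- `f` is a partial function recursive in the oracle set `O`. -/
def RecFunIn (O : Set ℕ) (f : ℕ →. ℕ) : Prop :=
  ∃ c : OCode, OCode.eval (chi O) c = f

/-- The code `c` computes the total function `f` relative to the oracle set `O`. -/
def ComputesIn (O : Set ℕ) (c : OCode) (f : ℕ → ℕ) : Prop :=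
  ∀ n, OCode.eval (chi O) c n = Part.some (f n)

/-- `f` is a total function computable in the oracle set `O`. -/
def TotalComputableIn (O : Set ℕ) (f : ℕ → ℕ) : Prop :=
  ∃ c : OCode, ComputesIn O c f

/-- The set `A` is computable in the oracle set `O`. -/
def SetRecIn (O A : Set ℕ) : Prop := RecFunIn O (chi A)

/-- Turing reducibility (on sets of naturals, regarded as representatives of
Turing degrees). -/
def TuringLE (A B : Set ℕ) : Prop := SetRecIn B A

/-- The set `A` is computably enumerable in the oracle set `O`. -/
def CEIn (O A : Set ℕ) : Prop :=
  ∃ c : OCode, ∀ n, n ∈ A ↔ (OCode.eval (chi O) c n).Dom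

/-- The Turing jump of a set of naturals. -/
def jump (O : Set ℕ) : Set ℕ :=
  { e | ∃ c : OCode, c.encodeCode = (Nat.unpair e).1 ∧
      (OCode.eval (chi O) c (Nat.unpair e).2).Dom }

/-- `0'`, the jump of the least degree. -/
def zeroJump : Set ℕ := jump ∅

/-- `0''`. -/
def zeroJump2 : Set ℕ := jump zeroJump

/-- `0'''`. -/
def zeroJump3 : Set ℕ := jump zeroJump2

/-! ### Languages and structures -/

/-- A (coded) first-order language: `relArity r = some k` means that `r` is the code of a
relation symbol of arity `k`, and similarly for function symbols. -/
structure Lang where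
  relArity : ℕ → Option ℕ
  funArity : ℕ → Option ℕ

/-- The language is computably represented. -/
def Lang.ComputableRep (L : Lang) : Prop :=
  TotalComputableIn ∅ (fun r => Encodable.encode (L.relArity r)) ∧
  TotalComputableIn ∅ (fun f => Encodable.encode (L.funArity f))

/-- A finite relational language. -/
def Lang.FiniteRelational (L : Lang) : Prop :=
  (∀ f, L.funArity f = none) ∧ { r | (L.relArity r).isSome = true }.Finite

/-- A finite language. -/
def Lang.FiniteLang (L : Lang) : Prop :=
  { r | (L.relArity r).isSome = true }.Finite ∧
  { f | (L.funArity f).isSome = true }.Finite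

/-- An `L`-structure with underlying set a set of naturals. -/
structure Str (L : Lang) where
  dom : Set ℕ
  rel : ℕ → List ℕ → Prop
  fn : ℕ → List ℕ → ℕ
  rel_valid : ∀ r as, rel r as → L.relArity r = some as.length ∧ ∀ x ∈ as, x ∈ dom
  fn_mem : ∀ f as, L.funArity f = some as.length → (∀ x ∈ as, x ∈ dom) → fn f as ∈ dom

variable {L : Lang}

/-- The (finite) tuple `as` lies in the structure `A`. -/
def TupleIn (A : Str L) (as : List ℕ) : Prop := ∀ x ∈ as, x ∈ A.dom

/-- Membership in the substructure of `A` generated by the tuple `s`. -/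
inductive InClosure (A : Str L) (s : List ℕ) : ℕ → Prop
  | base {x : ℕ} : x ∈ s → x ∈ A.dom → InClosure A s x
  | fn (f : ℕ) (as : List ℕ) : L.funArity f = some as.length →
      (∀ x ∈ as, InClosure A s x) → InClosure A s (A.fn f as)

theorem InClosure.mem_dom {A : Str L} {s : List ℕ} {x : ℕ}
    (h : InClosure A s x) : x ∈ A.dom := by
  induction h with
  | base _ hx => exact hx
  | fn f as ha _ ih => exact A.fn_mem f as ha ih

/-- The substructure of `A` generated by the tuple `s`. -/
def Str.sub (A : Str L) (s : List ℕ) : Str L where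
  dom := { x | InClosure A s x }
  rel r as := A.rel r as ∧ ∀ x ∈ as, InClosure A s x
  fn := A.fn
  rel_valid := fun r as h => ⟨(A.rel_valid r as h.1).1, h.2⟩
  fn_mem := fun f as ha hm => InClosure.fn f as ha hm

/-- `h` is an embedding of `A` into `B`. -/
def IsEmbMap (A B : Str L) (h : ℕ → ℕ) : Prop :=
  (∀ x ∈ A.dom, h x ∈ B.dom) ∧
  (∀ x ∈ A.dom, ∀ y ∈ A.dom, h x = h y → x = y) ∧
  (∀ r as, TupleIn A as → (A.rel r as ↔ B.rel r (as.map h))) ∧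
  (∀ f as, L.funArity f = some as.length → TupleIn A as →
    h (A.fn f as) = B.fn f (as.map h))

/-- `A` embeds into `B`. -/
def Embeds (A B : Str L) : Prop := ∃ h, IsEmbMap A B h

/-- `h` is an isomorphism of `A` onto `B`. -/
def IsIsoMap (A B : Str L) (h : ℕ → ℕ) : Prop :=
  IsEmbMap A B h ∧ ∀ y ∈ B.dom, ∃ x ∈ A.dom, h x = y

/-- `A` and `B` are isomorphic. -/
def Isom (A B : Str L) : Prop := ∃ h, IsIsoMap A B h

/-- `as ∼cl bs`: the coordinatewise map extends to an isomorphism of generated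
substructures. -/
def ClSim (A : Str L) (as : List ℕ) (B : Str L) (bs : List ℕ) : Prop :=
  ∃ h : ℕ → ℕ, as.map h = bs ∧ IsIsoMap (A.sub as) (B.sub bs) h

/-- `as ∼tuple bs`: equal length and the same pattern of equalities among coordinates. -/
def TupleSim (as bs : List ℕ) : Prop :=
  ∃ h h' : ℕ → ℕ, as.map h = bs ∧ bs.map h' = as

/-- `A` is finitely generated. -/
def Str.FG (A : Str L) : Prop :=
  ∃ s : List ℕ, TupleIn A s ∧ ∀ x, x ∈ A.dom ↔ InClosure A s x

/-- `g` is an automorphism of `M`. -/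
def IsAutoOf (M : Str L) (g : ℕ → ℕ) : Prop := IsIsoMap M M g

/-! ### Ages (as isomorphism-closed classes) -/

/-- `B` belongs to the age of `M`, i.e. `B` is isomorphic to a finitely generated
substructure of `M`. -/
def AgeMemOf (M : Str L) (B : Str L) : Prop :=
  ∃ as : List ℕ, TupleIn M as ∧ Isom B (M.sub as)

/-- The age of a structure `M`. -/
def ageOf (M : Str L) : Set (Str L) := { B | AgeMemOf M B }

/-- The hereditary property. -/
def HP (C : Set (Str L)) : Prop :=
  ∀ B ∈ C, ∀ as : List ℕ, TupleIn B as → B.sub as ∈ C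

/-- The joint embedding property. -/
def JEP (C : Set (Str L)) : Prop :=
  ∀ A ∈ C, ∀ B ∈ C, ∃ D ∈ C, Embeds A D ∧ Embeds B D

/-- Every pair of embeddings with domain `A` into members of `C` can be amalgamated
over `A` inside `C`. -/
def AmalgamatesOver (C : Set (Str L)) (A : Str L) : Prop :=
  ∀ B₀ ∈ C, ∀ B₁ ∈ C, ∀ f₀ f₁ : ℕ → ℕ, IsEmbMap A B₀ f₀ → IsEmbMap A B₁ f₁ →
    ∃ D ∈ C, ∃ g₀ g₁ : ℕ → ℕ, IsEmbMap B₀ D g₀ ∧ IsEmbMap B₁ D g₁ ∧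
      ∀ x ∈ A.dom, g₀ (f₀ x) = g₁ (f₁ x)

/-- The amalgamation property. -/
def AP (C : Set (Str L)) : Prop := ∀ A ∈ C, AmalgamatesOver C A

/-- `A` is an amalgamation base of the class `C`. -/
def AmalgBase (C : Set (Str L)) (A : Str L) : Prop := A ∈ C ∧ AmalgamatesOver C A

/-- The cofinal amalgamation property. -/
def CoAP (C : Set (Str L)) : Prop :=
  ∀ A ∈ C, ∃ A' : Str L, AmalgBase C A' ∧ Embeds A A'

/-! ### Computable ages -/

/-- An (abstract) enumerated age: for each index `i`, a generating tuple `tup i` and the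
structure `str i` it generates. -/
structure CompAge (L : Lang) where
  tup : ℕ → List ℕ
  str : ℕ → Str L
  tup_mem : ∀ i, TupleIn (str i) (tup i)
  gen : ∀ i x, x ∈ (str i).dom ↔ InClosure (str i) (tup i) x

/-- The class of structures represented by the enumerated age `K`. -/
def CompAge.cls (K : CompAge L) : Set (Str L) := { B | ∃ i, Isom B (K.str i) }

/-- The structure `M` is computable in the oracle set `s`. -/
def StrComputableIn (s : Set ℕ) (M : Str L) : Prop :=
  SetRecIn s M.dom ∧
  SetRecIn s { p | ∃ r as, TupleIn M as ∧ M.rel r as ∧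
      p = Nat.pair r (Encodable.encode as) } ∧
  SetRecIn s { p | ∃ f as b, L.funArity f = some as.length ∧ TupleIn M as ∧
      M.fn f as = b ∧ p = Nat.pair f (Nat.pair (Encodable.encode as) b) }

/-- The coded diagram of an enumerated age. -/
def CompAge.diag (K : CompAge L) : Set ℕ :=
  { p | ∃ i, p = Nat.pair 0 (Nat.pair i (Encodable.encode (K.tup i))) } ∪
  { p | ∃ i x, x ∈ (K.str i).dom ∧ p = Nat.pair 1 (Nat.pair i x) } ∪
  { p | ∃ i r as, TupleIn (K.str i) as ∧ (K.str i).rel r as ∧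
      p = Nat.pair 2 (Nat.pair i (Nat.pair r (Encodable.encode as))) } ∪
  { p | ∃ i r as, TupleIn (K.str i) as ∧ L.relArity r = some as.length ∧
      ¬ (K.str i).rel r as ∧
      p = Nat.pair 3 (Nat.pair i (Nat.pair r (Encodable.encode as))) } ∪
  { p | ∃ i f as b, TupleIn (K.str i) as ∧ L.funArity f = some as.length ∧
      (K.str i).fn f as = b ∧
      p = Nat.pair 4 (Nat.pair i (Nat.pair f (Nat.pair (Encodable.encode as) b))) }

/-- `K` is an `s`-computable age: its diagram is c.e. in `s` and each of its structures
is computable in `s`. -/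
def AgeComputableIn (s : Set ℕ) (K : CompAge L) : Prop :=
  CEIn s K.diag ∧ ∀ i, StrComputableIn s (K.str i)

/-- The embedding information of an enumerated age, as a set of naturals. -/
def EmbedInfo (K : CompAge L) : Set ℕ :=
  { p | ∃ k₀ b₀ k₁ b₁, TupleIn (K.str k₀) b₀ ∧ TupleIn (K.str k₁) b₁ ∧
      ClSim (K.str k₀) b₀ (K.str k₁) b₁ ∧
      p = Nat.pair k₀ (Nat.pair (Encodable.encode b₀)
            (Nat.pair k₁ (Encodable.encode b₁))) }

/-! ### Potential embeddings, spans, and amalgamation diagrams -/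

/-- A potential embedding: a pair of indices and a tuple in the codomain structure. -/
structure PotEmb where
  i : ℕ
  j : ℕ
  c : List ℕ

/-- A numerical code of a potential embedding. -/
def PotEmb.code (F : PotEmb) : ℕ :=
  Nat.pair F.i (Nat.pair F.j (Encodable.encode F.c))

/-- The potential embedding is well-formed with respect to `K`. -/
def PotEmb.Valid (K : CompAge L) (F : PotEmb) : Prop :=
  F.c.length = (K.tup F.i).length ∧ TupleIn (K.str F.j) F.c

/-- The potential embedding is an embedding. -/
def PotEmb.IsEmb (K : CompAge L) (F : PotEmb) : Prop :=
  ClSim (K.str F.i) (K.tup F.i) (K.str F.j) F.c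

/-- The potential embedding is an isomorphism (its range generates the codomain). -/
def PotEmb.IsIso (K : CompAge L) (F : PotEmb) : Prop :=
  F.IsEmb K ∧ ∀ x ∈ (K.str F.j).dom, InClosure (K.str F.j) F.c x

/-- `h` realizes the potential embedding `F` as a map on the domain structure. -/
def ExtMap (K : CompAge L) (F : PotEmb) (h : ℕ → ℕ) : Prop :=
  (K.tup F.i).map h = F.c ∧ IsEmbMap (K.str F.i) (K.str F.j) h

/-- `(F₀, F₁)` is a potential span. -/
def PotSpan (K : CompAge L) (F₀ F₁ : PotEmb) : Prop :=
  F₀.Valid K ∧ F₁.Valid K ∧ F₀.i = F₁.i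

/-- `(G₀, G₁)` is an amalgamation diagram over the potential span `(F₀, F₁)`. -/
def AmalgDiagOver (K : CompAge L) (F₀ F₁ G₀ G₁ : PotEmb) : Prop :=
  G₀.Valid K ∧ G₁.Valid K ∧ G₀.IsEmb K ∧
  G₀.i = F₀.j ∧ G₁.i = F₁.j ∧ G₀.j = G₁.j ∧
  (F₀.IsEmb K → F₁.IsEmb K → G₁.IsEmb K ∧
    ∀ h₀ h₁ : ℕ → ℕ, ExtMap K G₀ h₀ → ExtMap K G₁ h₁ →
      F₀.c.map h₀ = F₁.c.map h₁)

/-- `H` is the composition `F ∘ G` of potential embeddings (where `F` is an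
embedding realized by any `h` extending it). -/
def CompRel (K : CompAge L) (F G H : PotEmb) : Prop :=
  G.j = F.i ∧ H.i = G.i ∧ H.j = F.j ∧
  ∀ h : ℕ → ℕ, ExtMap K F h → H.c = G.c.map h

/-! ### Computable versions of HP, JEP, AP, coAP -/

/-- The `s`-computable hereditary property. -/
def CHP (s : Set ℕ) (K : CompAge L) : Prop :=
  ∃ c : OCode, ∀ i (b : List ℕ), TupleIn (K.str i) b →
    ∃ j, OCode.eval (chi s) c (Nat.pair i (Encodable.encode b)) = Part.some j ∧
      ClSim (K.str j) (K.tup j) (K.str i) b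

/-- The `s`-computable joint embedding property. -/
def CJEP (s : Set ℕ) (K : CompAge L) : Prop :=
  ∃ c : OCode, ∀ i j : ℕ, ∃ F G : PotEmb,
    OCode.eval (chi s) c (Nat.pair i j) = Part.some (Nat.pair F.code G.code) ∧
    F.Valid K ∧ G.Valid K ∧ F.IsEmb K ∧ G.IsEmb K ∧
    F.i = i ∧ G.i = j ∧ F.j = G.j

/-- The `s`-computable amalgamation property. -/
def CAP (s : Set ℕ) (K : CompAge L) : Prop :=
  ∃ c : OCode, ∀ F₀ F₁ : PotEmb, PotSpan K F₀ F₁ →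
    ∃ G₀ G₁ : PotEmb,
      OCode.eval (chi s) c (Nat.pair F₀.code F₁.code) =
        Part.some (Nat.pair G₀.code G₁.code) ∧
      AmalgDiagOver K F₀ F₁ G₀ G₁

/-- A family `W` of distinguished embeddings with amalgamation-base codomains, closed
under pre/post composition with isomorphisms, covering all domains. -/
def IsCoAPFamily (K : CompAge L) (W : Set PotEmb) : Prop :=
  (∀ F ∈ W, F.Valid K ∧ F.IsEmb K ∧ AmalgBase K.cls (K.str F.j)) ∧
  (∀ F ∈ W, ∀ G H : PotEmb, G.Valid K → G.IsIso K → G.j = F.i →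
      CompRel K F G H → H ∈ W) ∧
  (∀ F ∈ W, ∀ G H : PotEmb, G.Valid K → G.IsIso K → G.i = F.j →
      CompRel K G F H → H ∈ W) ∧
  (∀ i : ℕ, ∃ F ∈ W, F.i = i)

/-- The `s`-computable cofinal amalgamation property: there is an `s`-c.e. family of
distinguished embeddings onto amalgamation bases together with an `s`-computable
amalgamation function. -/
def CcoAP (s : Set ℕ) (K : CompAge L) : Prop :=
  ∃ W : Set PotEmb, IsCoAPFamily K W ∧
    CEIn s { p | ∃ F ∈ W, p = F.code } ∧
    ∃ c : OCode, ∀ F ∈ W, ∀ G₀ G₁ : PotEmb,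
      G₀.Valid K → G₁.Valid K → G₀.i = F.j → G₁.i = F.j →
      ∃ D₀ D₁ : PotEmb,
        OCode.eval (chi s) c (Nat.pair F.code (Nat.pair G₀.code G₁.code)) =
          Part.some (Nat.pair D₀.code D₁.code) ∧
        AmalgDiagOver K G₀ G₁ D₀ D₁

/-! ### Ultrahomogeneity -/

/-- `M` is ultrahomogeneous: every isomorphism between finitely generated substructures
extends to an automorphism. -/
def Ultrahomogeneous (M : Str L) : Prop :=
  ∀ as bs : List ℕ, TupleIn M as → TupleIn M bs → ClSim M as M bs →
    ∃ g : ℕ → ℕ, IsAutoOf M g ∧ as.map g = bs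

/-- `g` is a bijection of the underlying set of `M` with itself. -/
def BijOnDom (M : Str L) (g : ℕ → ℕ) : Prop :=
  (∀ x ∈ M.dom, g x ∈ M.dom) ∧
  (∀ x ∈ M.dom, ∀ y ∈ M.dom, g x = g y → x = y) ∧
  (∀ y ∈ M.dom, ∃ x ∈ M.dom, g x = y)

/-- `M` is `s`-computably ultrahomogeneous. -/
def CompUltrahom (s : Set ℕ) (M : Str L) : Prop :=
  ∃ c : OCode, ∀ as bs : List ℕ, TupleIn M as → TupleIn M bs →
    as.length = bs.length →
    ∃ e : ℕ,
      OCode.eval (chi s) c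
          (Nat.pair (Encodable.encode as) (Encodable.encode bs)) = Part.some e ∧
      ∃ c' : OCode, c'.encodeCode = e ∧ ∃ g : ℕ → ℕ, ComputesIn s c' g ∧
        BijOnDom M g ∧
        (ClSim M as M bs → IsAutoOf M g ∧ as.map g = bs)

/-! ### Cofinal ultrahomogeneity -/

/-- `M` is cofinally ultrahomogeneous. -/
def CofinallyUltrahomogeneous (M : Str L) : Prop :=
  ∀ as : List ℕ, TupleIn M as → ∃ bs : List ℕ, TupleIn M bs ∧
    (∀ x ∈ as, InClosure M bs x) ∧
    ∀ cs : List ℕ, TupleIn M cs → ClSim M bs M cs →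
      ∃ g : ℕ → ℕ, IsAutoOf M g ∧ bs.map g = cs

/-- `E` is a cofinal collection of tuples in `M`. -/
def IsCofinalCollection (M : Str L) (E : Set (List ℕ)) : Prop :=
  (∀ bs ∈ E, TupleIn M bs) ∧
  (∀ as : List ℕ, TupleIn M as → ∃ bs ∈ E, ∀ x ∈ as, InClosure M bs x) ∧
  (∀ bs ∈ E, ∀ as : List ℕ, (∀ x ∈ as, InClosure M bs x) → (as ++ bs) ∈ E) ∧
  (∀ as ∈ E, ∀ bs : List ℕ, TupleIn M bs → ClSim M as M bs → bs ∈ E)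

/-- `M` is cofinally ultrahomogeneous for the collection `E`: every isomorphism between
substructures generated by members of `E` extends to an automorphism. -/
def CofUltraFor (M : Str L) (E : Set (List ℕ)) : Prop :=
  ∀ as ∈ E, ∀ bs ∈ E, ClSim M as M bs →
    ∃ g : ℕ → ℕ, IsAutoOf M g ∧ as.map g = bs

/-- The set of codes of members of `E`. -/
def ECodes (E : Set (List ℕ)) : Set ℕ := { p | ∃ as ∈ E, p = Encodable.encode as }

/-- The functional part of `s`-computable cofinal ultrahomogeneity with respect to `E`. -/
def CofUltraFunIn (s : Set ℕ) (M : Str L) (E : Set (List ℕ)) : Prop :=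
  ∃ c : OCode, ∀ as ∈ E, ∀ bs : List ℕ, TupleIn M bs → TupleSim as bs →
    ∃ e : ℕ,
      OCode.eval (chi s) c
          (Nat.pair (Encodable.encode as) (Encodable.encode bs)) = Part.some e ∧
      ∃ c' : OCode, c'.encodeCode = e ∧ ∃ g : ℕ → ℕ, ComputesIn s c' g ∧
        BijOnDom M g ∧ as.map g = bs ∧
        (ClSim M as M bs → IsAutoOf M g)

/-- `M` is `s`-computably cofinally ultrahomogeneous with respect to `E`. -/
def CompCofUltrahomWrt (s : Set ℕ) (M : Str L) (E : Set (List ℕ)) : Prop :=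
  IsCofinalCollection M E ∧ SetRecIn s (ECodes E) ∧ CofUltraFunIn s M E

/-- `M` is `s`-computably cofinally ultrahomogeneous. -/
def CompCofUltrahom (s : Set ℕ) (M : Str L) : Prop :=
  ∃ E : Set (List ℕ), CompCofUltrahomWrt s M E

/-- The `s`-computable cofinal extension property with respect to `E`. -/
def CompCofExtProp (s : Set ℕ) (M : Str L) (E : Set (List ℕ)) : Prop :=
  ∃ c : OCode, ∀ as bs cs : List ℕ, as ∈ E → cs ∈ E → TupleIn M bs →
    (∀ x ∈ as, InClosure M cs x) → TupleSim as bs →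
    ∃ ds : List ℕ,
      OCode.eval (chi s) c
          (Nat.pair (Encodable.encode as)
            (Nat.pair (Encodable.encode bs) (Encodable.encode cs))) =
        Part.some (Encodable.encode ds) ∧
      TupleIn M ds ∧ TupleSim (as ++ cs) (bs ++ ds) ∧
      (ClSim M as M bs →
        ClSim M ds M cs ∧ (∀ x ∈ bs, InClosure M ds x) ∧
        ∀ h h' : ℕ → ℕ,
          ds.map h = cs → IsIsoMap (M.sub ds) (M.sub cs) h →
          bs.map h' = as → IsIsoMap (M.sub bs) (M.sub as) h' →
          bs.map h = bs.map h')

/-! ### Canonical ages and limits -/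

/-- `K` is a canonical age of `M` (relative to the oracle `t`): the enumeration of
generating tuples is `t`-computable, lists every finite tuple of `M` infinitely often,
and `str i` is the substructure generated by `tup i`. -/
def IsCanonicalAgeOf (t : Set ℕ) (K : CompAge L) (M : Str L) : Prop :=
  TotalComputableIn t (fun i => Encodable.encode (K.tup i)) ∧
  (∀ i, TupleIn M (K.tup i)) ∧
  (∀ as : List ℕ, TupleIn M as → ∀ n : ℕ, ∃ i, n ≤ i ∧ K.tup i = as) ∧
  (∀ i, K.str i = M.sub (K.tup i))

/-- `K` represents the age of `M`. -/
def RepresentsAgeOf (K : CompAge L) (M : Str L) : Prop :=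
  (∀ i, AgeMemOf M (K.str i)) ∧
  (∀ B : Str L, AgeMemOf M B → ∃ i, Isom B (K.str i))

/-- `M` is a cofinal Fraïssé limit of (the age represented by) `K`. -/
def CofinalFraisseLimitOf (K : CompAge L) (M : Str L) : Prop :=
  CofinallyUltrahomogeneous M ∧ RepresentsAgeOf K M

/-- The enumerated age `K` is uniformly finite. -/
def UniformlyFinite (K : CompAge L) : Prop :=
  L.FiniteLang ∧ ∃ f : ℕ → ℕ, TotalComputableIn ∅ f ∧
    ∀ i, ∀ as : List ℕ, TupleIn (K.str i) as →
      { x | InClosure (K.str i) as x }.Finite ∧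
      { x | InClosure (K.str i) as x }.ncard ≤ f as.length

/-! ### Oracle codes and partial recursive functions -/

theorem exists_oCode_of_partrec (O : Set ℕ) {f : ℕ →. ℕ} (hf : Nat.Partrec f) :
    ∃ c : OCode, OCode.eval (chi O) c = f := by
  obtain ⟨d, rfl⟩ := Nat.Partrec.Code.exists_code.1 hf
  clear hf
  induction d with
  | zero => exact ⟨.zero, rfl⟩
  | succ => exact ⟨.succ, rfl⟩
  | left => exact ⟨.left, rfl⟩
  | right => exact ⟨.right, rfl⟩
  | pair a b iha ihb =>
    obtain ⟨a', ha⟩ := iha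
    obtain ⟨b', hb⟩ := ihb
    exact ⟨.pair a' b', by simp only [OCode.eval, Nat.Partrec.Code.eval, ha, hb]; rfl⟩
  | comp a b iha ihb =>
    obtain ⟨a', ha⟩ := iha
    obtain ⟨b', hb⟩ := ihb
    exact ⟨.comp a' b', by simp only [OCode.eval, Nat.Partrec.Code.eval, ha, hb]; rfl⟩
  | prec a b iha ihb =>
    obtain ⟨a', ha⟩ := iha
    obtain ⟨b', hb⟩ := ihb
    exact ⟨.prec a' b', by simp only [OCode.eval, Nat.Partrec.Code.eval, ha, hb]; rfl⟩
  | rfind' a iha =>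
    obtain ⟨a', ha⟩ := iha
    exact ⟨.rfind' a', by simp only [OCode.eval, Nat.Partrec.Code.eval, ha]; rfl⟩

theorem exists_code_of_oCode_empty (c : OCode) :
    ∃ d : Nat.Partrec.Code, d.eval = OCode.eval (chi ∅) c := by
  induction c with
  | zero => exact ⟨.zero, rfl⟩
  | succ => exact ⟨.succ, rfl⟩
  | left => exact ⟨.left, rfl⟩
  | right => exact ⟨.right, rfl⟩
  | oracle =>
    refine ⟨.zero, ?_⟩
    funext n
    simp [OCode.eval, Nat.Partrec.Code.eval, chi, pure, PFun.pure]
  | pair a b iha ihb =>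
    obtain ⟨a', ha⟩ := iha
    obtain ⟨b', hb⟩ := ihb
    exact ⟨.pair a' b', by simp only [OCode.eval, Nat.Partrec.Code.eval, ha, hb]; rfl⟩
  | comp a b iha ihb =>
    obtain ⟨a', ha⟩ := iha
    obtain ⟨b', hb⟩ := ihb
    exact ⟨.comp a' b', by simp only [OCode.eval, Nat.Partrec.Code.eval, ha, hb]; rfl⟩
  | prec a b iha ihb =>
    obtain ⟨a', ha⟩ := iha
    obtain ⟨b', hb⟩ := ihb
    exact ⟨.prec a' b', by simp only [OCode.eval, Nat.Partrec.Code.eval, ha, hb]; rfl⟩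
  | rfind' a iha =>
    obtain ⟨a', ha⟩ := iha
    exact ⟨.rfind' a', by simp only [OCode.eval, Nat.Partrec.Code.eval, ha]; rfl⟩

namespace TotalComputableIn

variable {O : Set ℕ}

theorem of_computable {f : ℕ → ℕ} (hf : Computable f) : TotalComputableIn O f := by
  obtain ⟨c, hc⟩ := exists_oCode_of_partrec O (Partrec.nat_iff.1 hf)
  exact ⟨c, fun n => by rw [hc]; rfl⟩

theorem computable {f : ℕ → ℕ} (hf : TotalComputableIn ∅ f) : Computable f := by
  obtain ⟨c, hc⟩ := hf
  obtain ⟨d, hd⟩ := exists_code_of_oCode_empty c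
  have h : Nat.Partrec (fun n => (Part.some (f n) : Part ℕ)) := by
    refine Nat.Partrec.Code.exists_code.2 ⟨d, ?_⟩
    rw [hd]
    exact funext hc
  exact Partrec.nat_iff.2 h

theorem eval_comp {c d : OCode} {n m : ℕ} (h : OCode.eval (chi O) d n = Part.some m) :
    OCode.eval (chi O) (.comp c d) n = OCode.eval (chi O) c m := by
  show Part.bind (OCode.eval (chi O) d n) (OCode.eval (chi O) c) = _
  rw [h]
  exact Part.bind_some _ _

theorem comp {f g : ℕ → ℕ} (hf : TotalComputableIn O f) (hg : TotalComputableIn O g) :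
    TotalComputableIn O (fun n => f (g n)) := by
  obtain ⟨c, hc⟩ := hf
  obtain ⟨d, hd⟩ := hg
  refine ⟨.comp c d, fun n => ?_⟩
  exact (eval_comp (hd n)).trans (hc _)

theorem pair {f g : ℕ → ℕ} (hf : TotalComputableIn O f) (hg : TotalComputableIn O g) :
    TotalComputableIn O (fun n => Nat.pair (f n) (g n)) := by
  obtain ⟨c, hc⟩ := hf
  obtain ⟨d, hd⟩ := hg
  refine ⟨.pair c d, fun n => ?_⟩
  show Nat.pair <$> OCode.eval (chi O) c n <*> OCode.eval (chi O) d n = _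
  rw [hd n, hc n]
  simp [Seq.seq]

theorem oracle : TotalComputableIn O (fun n => if n ∈ O then 1 else 0) :=
  ⟨.oracle, fun _ => rfl⟩

theorem prec {f g : ℕ → ℕ} (hf : TotalComputableIn O f) (hg : TotalComputableIn O g) :
    TotalComputableIn O (fun p => Nat.rec (f p.unpair.1)
      (fun y ih => g (Nat.pair p.unpair.1 (Nat.pair y ih))) p.unpair.2) := by
  obtain ⟨c, hc⟩ := hf
  obtain ⟨d, hd⟩ := hg
  refine ⟨.prec c d, fun p => ?_⟩
  have key : ∀ n, (Nat.rec (OCode.eval (chi O) c p.unpair.1) (fun y IH =>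
      Part.bind IH fun i => OCode.eval (chi O) d (Nat.pair p.unpair.1 (Nat.pair y i))) n :
        Part ℕ) = Part.some (Nat.rec (f p.unpair.1)
      (fun y ih => g (Nat.pair p.unpair.1 (Nat.pair y ih))) n) := by
    intro n
    induction n with
    | zero => exact hc _
    | succ y ih => simp only [ih, Part.bind_some]; exact hd _
  exact key _

theorem find {f : ℕ → ℕ} (hf : TotalComputableIn O f)
    (h : ∀ a, ∃ n, f (Nat.pair a n) = 0) :
    TotalComputableIn O (fun a => Nat.find (h a)) := by
  have h0 : TotalComputableIn O (fun a => Nat.pair a 0) :=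
    of_computable (Primrec₂.natPair.comp .id (.const 0)).to_comp
  obtain ⟨c, hc⟩ := hf
  suffices h' : ∀ a, OCode.eval (chi O) (.rfind' c) (Nat.pair a 0) =
      Part.some (Nat.find (h a)) by
    obtain ⟨d, hd⟩ := h0
    refine ⟨.comp (.rfind' c) d, fun a => ?_⟩
    exact (eval_comp (hd a)).trans (h' a)
  intro a
  have hp : ∀ n, Part.map (fun m => decide (m = 0)) (OCode.eval (chi O) c (Nat.pair a (n + 0))) =
      Part.some (decide (f (Nat.pair a n) = 0)) := fun n => by
    rw [add_zero, hc (Nat.pair a n), Part.map_some]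
  have hf : Nat.find (h a) ∈ Nat.rfind fun n =>
      Part.map (fun m => decide (m = 0)) (OCode.eval (chi O) c (Nat.pair a (n + 0))) := by
    refine Nat.mem_rfind.2 ⟨?_, fun {m} hm => ?_⟩
    · refine (hp _).symm ▸ Part.mem_some_iff.2 ?_
      simp [Nat.find_spec (h a)]
    · refine (hp _).symm ▸ Part.mem_some_iff.2 ?_
      simpa using Nat.find_min (h a) hm
  show (Nat.unpaired fun a m => Part.map (· + m) (Nat.rfind fun n =>
    Part.map (fun m => decide (m = 0)) (OCode.eval (chi O) c (Nat.pair a (n + m)))))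
      (Nat.pair a 0) = _
  rw [Nat.unpaired, Nat.unpair_pair, Part.eq_some_iff]
  exact Part.mem_map_iff _ |>.2 ⟨_, hf, rfl⟩

end TotalComputableIn

/-! ### Total functions, decidable and enumerable predicates relative to an oracle -/

section

variable {α β γ δ : Type*} [Primcodable α] [Primcodable β] [Primcodable γ] [Primcodable δ]

/-- The total function `f` between encoded types is computable in the oracle set `O`. -/
def CompIn (O : Set ℕ) (f : α → β) : Prop :=
  ∃ F : ℕ → ℕ, TotalComputableIn O F ∧ ∀ a, F (Encodable.encode a) = Encodable.encode (f a)

/-- The predicate `p` on an encoded type is decidable in the oracle set `O`. -/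
def DecIn (O : Set ℕ) (p : α → Prop) : Prop :=
  ∃ f : α → Bool, CompIn O f ∧ ∀ a, p a ↔ f a = true

/-- The predicate `p` on an encoded type is computably enumerable in the oracle set `O`. -/
def EnumIn (O : Set ℕ) (p : α → Prop) : Prop :=
  ∃ f : α × ℕ → Bool, CompIn O f ∧ ∀ a, p a ↔ ∃ w, f (a, w) = true

variable {O : Set ℕ}

namespace CompIn

theorem of_computable {f : α → β} (hf : Computable f) : CompIn O f := by
  refine ⟨fun n => Nat.pred (Encodable.encode ((Encodable.decode (α := α) n).map f)),
    .of_computable ?_, fun a => by simp⟩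
  exact Primrec.pred.to_comp.comp
    (Computable.encode.comp (Computable.option_map Computable.decode (hf.comp Computable.snd)))

theorem of_primrec {f : α → β} (hf : Primrec f) : CompIn O f := of_computable hf.to_comp

theorem comp {f : β → γ} {g : α → β} (hf : CompIn O f) (hg : CompIn O g) :
    CompIn O (fun a => f (g a)) := by
  obtain ⟨F, hF, hF'⟩ := hf
  obtain ⟨G, hG, hG'⟩ := hg
  exact ⟨_, hF.comp hG, fun a => by rw [hG', hF']⟩

theorem pair {f : α → β} {g : α → γ} (hf : CompIn O f) (hg : CompIn O g) :
    CompIn O (fun a => (f a, g a)) := by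
  obtain ⟨F, hF, hF'⟩ := hf
  obtain ⟨G, hG, hG'⟩ := hg
  exact ⟨_, hF.pair hG, fun a => by rw [hG', hF', Encodable.encode_prod_val]⟩

theorem nat_rec {f : α → β} {g : α × ℕ × β → β} (hf : CompIn O f) (hg : CompIn O g) :
    CompIn O (fun p : α × ℕ => (Nat.rec (f p.1) (fun y ih => g (p.1, y, ih)) p.2 : β)) := by
  obtain ⟨F, hF, hF'⟩ := hf
  obtain ⟨G, hG, hG'⟩ := hg
  refine ⟨_, hF.prec hG, fun ⟨a, n⟩ => ?_⟩
  simp only [Encodable.encode_prod_val, Nat.unpair_pair, Encodable.encode_nat]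
  induction n with
  | zero => exact hF' a
  | succ n ih =>
    simp only [ih]
    rw [← hG']
    simp only [Encodable.encode_prod_val, Encodable.encode_nat]

theorem find {f : α × ℕ → Bool} (hf : CompIn O f) (h : ∀ a, ∃ n, f (a, n) = true) :
    CompIn O (fun a => Nat.find (h a)) := by
  have hf1 : CompIn O (fun q : α × ℕ => !f q) := (of_primrec Primrec.not).comp hf
  obtain ⟨F, hF, hF'⟩ := hf1
  have hF1 : ∀ a n, F (Nat.pair (Encodable.encode a) n) = 0 ↔ f (a, n) = true := by
    intro a n
    have := hF' (a, n)
    simp only [Encodable.encode_prod_val, Encodable.encode_nat] at this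
    rw [this]
    cases f (a, n) <;> simp
  let N : ℕ → ℕ := fun p => Encodable.encode (Encodable.decode (α := α) p.unpair.1)
  have hN : TotalComputableIn O N := .of_computable (Primrec.encode.comp
    (Primrec.decode.comp (Primrec.fst.comp Primrec.unpair))).to_comp
  have hN' : TotalComputableIn O (fun p => Nat.pair (N p).pred p.unpair.2) :=
    .pair (.comp (.of_computable Primrec.pred.to_comp) hN)
      (.of_computable (Primrec.snd.comp Primrec.unpair).to_comp)
  have hm : TotalComputableIn O (fun p : ℕ => p.unpair.1 * p.unpair.2) :=
    .of_computable (Primrec.nat_mul.comp (Primrec.fst.comp Primrec.unpair)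
      (Primrec.snd.comp Primrec.unpair)).to_comp
  have hG := hm.comp (hN.pair (hF.comp hN'))
  simp only [Nat.unpair_pair] at hG
  have hdec : ∀ p a n, Encodable.decode (α := α) p = some a →
      (N (Nat.pair p n) * F (Nat.pair (N (Nat.pair p n)).pred (Nat.pair p n).unpair.2) = 0 ↔
        f (a, n) = true) := by
    intro p a n hp
    rw [← hF1]
    simp [N, hp]
  have hG0 : ∀ p, ∃ n, N (Nat.pair p n) *
      F (Nat.pair (N (Nat.pair p n)).pred (Nat.pair p n).unpair.2) = 0 := by
    intro p
    cases hd : Encodable.decode (α := α) p with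
    | none => exact ⟨0, by simp [N, hd]⟩
    | some a =>
      obtain ⟨n, hn⟩ := h a
      exact ⟨n, (hdec _ _ _ hd).2 hn⟩
  refine ⟨_, hG.find hG0, fun a => ?_⟩
  rw [Encodable.encode_nat]
  exact Nat.find_congr' fun {n} => hdec _ _ _ (Encodable.encodek a)

end CompIn

/-- A total relation that is enumerable in `O` has a choice function computable in `O`. -/
theorem EnumIn.exists_compIn [Inhabited β] {p : α × β → Prop} (hp : EnumIn O p)
    (h : ∀ a, ∃ b, p (a, b)) : ∃ g : α → β, CompIn O g ∧ ∀ a, p (a, g a) := by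
  obtain ⟨f, hf, hf'⟩ := hp
  let d : ℕ → β := fun n => (Encodable.decode n.unpair.1).getD default
  have hd : Primrec d := Primrec.option_getD_default.comp
    (Primrec.decode.comp (Primrec.fst.comp Primrec.unpair))
  have hq : CompIn O (fun q : α × ℕ => f ((q.1, d q.2), q.2.unpair.2)) :=
    hf.comp (.of_primrec ((Primrec.fst.pair (hd.comp .snd)).pair
      (Primrec.snd.comp (Primrec.unpair.comp .snd))))
  have hex : ∀ a, ∃ n, f ((a, d n), n.unpair.2) = true := by
    intro a
    obtain ⟨b, hb⟩ := h a
    obtain ⟨w, hw⟩ := (hf' _).1 hb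
    exact ⟨Nat.pair (Encodable.encode b) w, by simpa [d] using hw⟩
  exact ⟨_, (CompIn.of_primrec hd).comp (hq.find hex),
    fun a => (hf' _).2 ⟨_, Nat.find_spec (hex a)⟩⟩

theorem TotalComputableIn.of_compIn {f : ℕ → ℕ} (hf : CompIn O f) : TotalComputableIn O f := by
  obtain ⟨F, hF, h⟩ := hf
  exact (funext h : F = f) ▸ hF

namespace DecIn

theorem of_primrecPred {p : α → Prop} (hp : PrimrecPred p) : DecIn O p := by
  obtain ⟨_, h⟩ := hp
  exact ⟨_, .of_primrec h, fun a => by simp⟩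

theorem of_computable {p : α → Prop} {f : α → Bool} (hf : Computable f)
    (h : ∀ a, p a ↔ f a = true) : DecIn O p :=
  ⟨f, .of_computable hf, h⟩

theorem oracle : DecIn O (fun n : ℕ => n ∈ O) := by
  refine ⟨fun n => decide (n ∈ O), ⟨_, TotalComputableIn.oracle, fun n => ?_⟩, fun n => by simp⟩
  rw [Encodable.encode_nat]
  by_cases h : n ∈ O <;> simp [h]

theorem comp {p : β → Prop} {f : α → β} (hp : DecIn O p) (hf : CompIn O f) :
    DecIn O (fun a => p (f a)) := by
  obtain ⟨g, hg, h⟩ := hp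
  exact ⟨_, hg.comp hf, fun a => h _⟩

theorem of_iff {p q : α → Prop} (hp : DecIn O p) (h : ∀ a, q a ↔ p a) : DecIn O q := by
  obtain ⟨g, hg, hg'⟩ := hp
  exact ⟨g, hg, fun a => (h a).trans (hg' a)⟩

theorem not {p : α → Prop} (hp : DecIn O p) : DecIn O (fun a => ¬ p a) := by
  obtain ⟨g, hg, h⟩ := hp
  exact ⟨fun a => !g a, (CompIn.of_primrec Primrec.not).comp hg, fun a => by simp [h]⟩

theorem and {p q : α → Prop} (hp : DecIn O p) (hq : DecIn O q) :
    DecIn O (fun a => p a ∧ q a) := by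
  obtain ⟨f, hf, hf'⟩ := hp
  obtain ⟨g, hg, hg'⟩ := hq
  exact ⟨fun a => f a && g a, (CompIn.of_primrec (f := fun x : Bool × Bool => x.1 && x.2)
    Primrec.and).comp (hf.pair hg), fun a => by simp [hf', hg']⟩

theorem ball_lt {p : α × ℕ → Prop} (hp : DecIn O p) :
    DecIn O (fun q : α × ℕ => ∀ i < q.2, p (q.1, i)) := by
  obtain ⟨f, hf, hf'⟩ := hp
  have h1 : CompIn O (fun q : α × ℕ × Bool => q.2.2 && f (q.1, q.2.1)) :=
    (CompIn.of_primrec (f := fun x : Bool × Bool => x.1 && x.2) Primrec.and).comp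
      ((CompIn.of_primrec (Primrec.snd.comp .snd)).pair
        (hf.comp (.of_primrec (Primrec.fst.pair (Primrec.fst.comp .snd)))))
  refine ⟨_, CompIn.nat_rec (.of_primrec (Primrec.const true)) h1, fun ⟨a, n⟩ => ?_⟩
  simp only
  induction n with
  | zero => simp
  | succ n ih =>
    simp only [Bool.and_eq_true, ← ih, ← hf']
    exact Nat.forall_lt_succ_right

theorem ball_list [Inhabited β] {p : α × β → Prop} (hp : DecIn O p) :
    DecIn O (fun q : α × List β => ∀ x ∈ q.2, p (q.1, x)) := by
  have h1 : DecIn O (fun q : (α × List β) × ℕ => p (q.1.1, q.1.2.getD q.2 default)) :=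
    hp.comp (.of_primrec ((Primrec.fst.comp .fst).pair
      ((Primrec.list_getD default).comp (Primrec.snd.comp .fst) .snd)))
  refine (h1.ball_lt.comp (.of_primrec (Primrec.id.pair
    (Primrec.list_length.comp .snd)))).of_iff fun ⟨a, l⟩ => ?_
  simp only [List.forall_mem_iff_getElem]
  exact forall₂_congr fun i hi => by simp [List.getElem?_eq_getElem hi]

theorem exists_lt {p : α × ℕ → Prop} (hp : DecIn O p) :
    DecIn O (fun q : α × ℕ => ∃ i < q.2, p (q.1, i)) :=
  hp.not.ball_lt.not.of_iff fun q => by simp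

theorem enumIn {p : α → Prop} (hp : DecIn O p) : EnumIn O p := by
  obtain ⟨f, hf, h⟩ := hp
  exact ⟨_, hf.comp (.of_primrec .fst), fun a => by simp [h]⟩

end DecIn

namespace EnumIn

theorem comp {p : β → Prop} {f : α → β} (hp : EnumIn O p) (hf : CompIn O f) :
    EnumIn O (fun a => p (f a)) := by
  obtain ⟨g, hg, h⟩ := hp
  exact ⟨_, hg.comp ((hf.comp (.of_primrec .fst)).pair (.of_primrec .snd)), fun a => h _⟩

theorem of_iff {p q : α → Prop} (hp : EnumIn O p) (h : ∀ a, q a ↔ p a) : EnumIn O q := by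
  obtain ⟨g, hg, hg'⟩ := hp
  exact ⟨g, hg, fun a => (h a).trans (hg' a)⟩

theorem ex [Inhabited β] {p : α × β → Prop} (hp : EnumIn O p) :
    EnumIn O (fun a => ∃ b, p (a, b)) := by
  obtain ⟨f, hf, hf'⟩ := hp
  let d : ℕ → β := fun n => (Encodable.decode n.unpair.1).getD default
  have hd : Primrec d := Primrec.option_getD_default.comp
    (Primrec.decode.comp (Primrec.fst.comp Primrec.unpair))
  have hq : CompIn O (fun q : α × ℕ => f ((q.1, d q.2), q.2.unpair.2)) :=
    hf.comp (.of_primrec ((Primrec.fst.pair (hd.comp .snd)).pair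
      (Primrec.snd.comp (Primrec.unpair.comp .snd))))
  refine ⟨_, hq, fun a => ⟨?_, fun ⟨w, hw⟩ => ⟨_, (hf' _).2 ⟨_, hw⟩⟩⟩⟩
  rintro ⟨b, hb⟩
  obtain ⟨w, hw⟩ := (hf' _).1 hb
  exact ⟨Nat.pair (Encodable.encode b) w, by simpa [d] using hw⟩

theorem and {p q : α → Prop} (hp : EnumIn O p) (hq : EnumIn O q) :
    EnumIn O (fun a => p a ∧ q a) := by
  obtain ⟨f, hf, hf'⟩ := hp
  obtain ⟨g, hg, hg'⟩ := hq
  have h1 : DecIn O (fun r : (α × ℕ) × ℕ => f r.1 = true) :=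
    ⟨_, hf.comp (.of_primrec .fst), fun _ => Iff.rfl⟩
  have h2 : DecIn O (fun r : (α × ℕ) × ℕ => g (r.1.1, r.2) = true) :=
    ⟨_, hg.comp (.of_primrec ((Primrec.fst.comp .fst).pair .snd)), fun _ => Iff.rfl⟩
  exact (h1.and h2).enumIn.ex.ex.of_iff fun a => by simp [hf', hg']

theorem or {p q : α → Prop} (hp : EnumIn O p) (hq : EnumIn O q) :
    EnumIn O (fun a => p a ∨ q a) := by
  obtain ⟨f, hf, hf'⟩ := hp
  obtain ⟨g, hg, hg'⟩ := hq
  refine ⟨fun r => f r || g r, (CompIn.of_primrec (f := fun x : Bool × Bool => x.1 || x.2)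
    Primrec.or).comp (hf.pair hg), fun a => ?_⟩
  simp [hf', hg', exists_or]

theorem decIn {p : α → Prop} (hp : EnumIn O p) (hn : EnumIn O (fun a => ¬ p a)) :
    DecIn O p := by
  have h1 : EnumIn O (fun q : α × Bool => (p q.1 ∧ q.2 = true) ∨ (¬ p q.1 ∧ q.2 = false)) := by
    have hb : ∀ b : Bool, EnumIn O (fun q : α × Bool => q.2 = b) := fun b =>
      (DecIn.of_primrecPred (Primrec.eq.comp .snd (.const b))).enumIn
    exact ((hp.comp (.of_primrec .fst)).and (hb true)).or
      ((hn.comp (.of_primrec .fst)).and (hb false))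
  obtain ⟨g, hg, h⟩ := h1.exists_compIn fun a => by
    by_cases ha : p a
    · exact ⟨true, .inl ⟨ha, rfl⟩⟩
    · exact ⟨false, .inr ⟨ha, rfl⟩⟩
  refine ⟨g, hg, fun a => ?_⟩
  rcases h a with h | h <;> simp_all

theorem of_cEIn_empty {A : Set ℕ} (hA : CEIn ∅ A) : EnumIn O (fun n => n ∈ A) := by
  obtain ⟨c, hc⟩ := hA
  obtain ⟨d, hd⟩ := exists_code_of_oCode_empty c
  refine ⟨fun q => (Nat.Partrec.Code.evaln q.2 d q.1).isSome, .of_primrec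
    (Primrec.option_isSome.comp (Nat.Partrec.Code.primrec_evaln.comp
      ((Primrec.snd.pair (.const d)).pair .fst))), fun n => ?_⟩
  show n ∈ A ↔ _
  rw [hc, ← hd, Part.dom_iff_mem]
  simp only [Nat.Partrec.Code.evaln_complete, Option.isSome_iff_exists, Option.mem_def]
  exact exists_comm

end EnumIn

theorem DecIn.setRecIn {A : Set ℕ} (h : DecIn O (fun n => n ∈ A)) : SetRecIn O A := by
  obtain ⟨f, hf, hf'⟩ := h
  have h1 : CompIn O (fun n => Encodable.encode (f n)) :=
    (CompIn.of_primrec Primrec.encode).comp hf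
  obtain ⟨c, hc⟩ := TotalComputableIn.of_compIn h1
  refine ⟨c, funext fun n => (hc n).trans ?_⟩
  rw [chi]
  by_cases hn : n ∈ A
  · simp [hn, (hf' n).1 hn]
  · have : f n = false := by simpa [hn] using hf' n
    simp [hn, this]

/-- Uniformly in `a`, an index of the section at `a` of a function computable in `O`. -/
theorem CompIn.exists_index {f : α × ℕ → ℕ} (hf : CompIn O f) :
    ∃ e : OCode, ∀ a, ∃ i, OCode.eval (chi O) e (Encodable.encode a) = Part.some i ∧
      ∃ c : OCode, c.encodeCode = i ∧ ComputesIn O c (fun x => f (a, x)) := by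
  obtain ⟨F, ⟨d, hd⟩, hF⟩ := hf
  let k : ℕ → OCode := fun n => n.rec .zero fun _ c => .comp .succ c
  have hk : ∀ n m, OCode.eval (chi O) (k n) m = Part.some n := by
    intro n
    induction n with
    | zero => exact fun m => rfl
    | succ n ih => exact fun m => (TotalComputableIn.eval_comp (ih m)).trans rfl
  let s : ℕ → OCode := fun n => .comp d (.pair (k n) (.pair .left .right))
  have hs : ∀ n m, OCode.eval (chi O) (s n) m = Part.some (F (Nat.pair n m)) := by
    intro n m
    refine (TotalComputableIn.eval_comp (m := Nat.pair n m) ?_).trans (hd _)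
    show Nat.pair <$> OCode.eval (chi O) (k n) m <*>
      (Nat.pair <$> Part.some m.unpair.1 <*> Part.some m.unpair.2) = _
    rw [hk]
    simp [Seq.seq]
  have hkp : Primrec (fun n => (k n).encodeCode) := by
    have := Primrec.nat_rec₁ (f := fun _ c => 4 * Nat.pair 1 c + 6) 0
      (Primrec.nat_add.comp (Primrec.nat_mul.comp (.const 4)
        (Primrec₂.natPair.comp (.const 1) .snd)) (.const 6))
    refine this.of_eq fun n => ?_
    induction n with
    | zero => rfl
    | succ n ih => simp only [ih]; rfl
  have hsp : Primrec (fun n => (s n).encodeCode) :=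
    Primrec.nat_add.comp (Primrec.nat_mul.comp (.const 4)
      (Primrec₂.natPair.comp (.const d.encodeCode)
        (Primrec.nat_add.comp (Primrec.nat_mul.comp (.const 4)
          (Primrec₂.natPair.comp hkp
            (.const (OCode.pair .left .right).encodeCode))) (.const 5)))) (.const 6)
  obtain ⟨e, he⟩ := TotalComputableIn.of_computable (O := O) hsp.to_comp
  refine ⟨e, fun a => ⟨_, he _, _, rfl, fun x => ?_⟩⟩
  rw [hs]
  have := hF (a, x)
  simp only [Encodable.encode_prod_val, Encodable.encode_nat] at this
  rw [this]

end

/-! ### Embeddings and the relation `ClSim` -/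

theorem map_congr_mem {α β : Type*} {f g : α → β} {l : List α} (h : ∀ x ∈ l, f x = g x) :
    l.map f = l.map g := List.map_congr_left h

theorem TupleIn.of_closure {A : Str L} {s as : List ℕ} (h : ∀ x ∈ as, InClosure A s x) :
    TupleIn A as := fun x hx => (h x hx).mem_dom

theorem InClosure.trans {A : Str L} {s t : List ℕ} {x : ℕ} (hx : InClosure A t x)
    (h : ∀ y ∈ t, InClosure A s y) : InClosure A s x := by
  induction hx with
  | base hy _ => exact h _ hy
  | fn f as ha _ ih => exact .fn f as ha ih

theorem InClosure.self {A : Str L} {s : List ℕ} (hs : TupleIn A s) :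
    ∀ x ∈ s, InClosure A s x := fun x hx => .base hx (hs x hx)

namespace IsEmbMap

variable {A B C : Str L} {g h : ℕ → ℕ}

theorem id : IsEmbMap A A (fun x => x) :=
  ⟨fun _ hx => hx, fun _ _ _ _ h => h, fun _ _ _ => by simp, fun _ _ _ _ => by simp⟩

theorem comp (hg : IsEmbMap B C g) (hh : IsEmbMap A B h) :
    IsEmbMap A C (fun x => g (h x)) := by
  have ht : ∀ as, TupleIn A as → TupleIn B (as.map h) := fun as has y hy => by
    obtain ⟨x, hx, rfl⟩ := List.mem_map.1 hy
    exact hh.1 x (has x hx)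
  refine ⟨fun x hx => hg.1 _ (hh.1 x hx), fun x hx y hy e =>
    hh.2.1 x hx y hy (hg.2.1 _ (hh.1 x hx) _ (hh.1 y hy) e), fun r as has => ?_,
    fun f as hf has => ?_⟩
  · rw [hh.2.2.1 r as has, hg.2.2.1 r _ (ht as has), List.map_map]; rfl
  · show g (h _) = _
    rw [hh.2.2.2 f as hf has, hg.2.2.2 f _ (by simpa using hf) (ht as has), List.map_map]; rfl

theorem tupleIn (hh : IsEmbMap A B h) {as : List ℕ} (has : TupleIn A as) :
    TupleIn B (as.map h) := fun y hy => by
  obtain ⟨x, hx, rfl⟩ := List.mem_map.1 hy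
  exact hh.1 x (has x hx)

theorem closure (hh : IsEmbMap A B h) {s : List ℕ} {x : ℕ} (hx : InClosure A s x) :
    InClosure B (s.map h) (h x) := by
  induction hx with
  | base hx hd => exact .base (List.mem_map_of_mem hx) (hh.1 _ hd)
  | fn f as ha hm ih =>
    rw [hh.2.2.2 f as ha (TupleIn.of_closure hm)]
    refine .fn f _ (by simpa using ha) fun y hy => ?_
    obtain ⟨x, hx, rfl⟩ := List.mem_map.1 hy
    exact ih x hx

/-- An embedding restricts to a generated substructure. -/
theorem sub (hh : IsEmbMap A B h) (s : List ℕ) : IsEmbMap (A.sub s) B h := by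
  refine ⟨fun x hx => hh.1 x hx.mem_dom, fun x hx y hy => hh.2.1 x hx.mem_dom y hy.mem_dom,
    fun r as has => ?_, fun f as hf has => hh.2.2.2 f as hf (TupleIn.of_closure has)⟩
  rw [← hh.2.2.1 r as (TupleIn.of_closure has)]
  exact ⟨fun h => h.1, fun h => ⟨h, has⟩⟩

end IsEmbMap

theorem sub_closure {A : Str L} {s t : List ℕ} {x : ℕ} (ht : ∀ y ∈ t, InClosure A s y)
    (hx : InClosure A t x) : InClosure (A.sub s) t x := by
  induction hx with
  | base hy _ => exact .base hy (ht _ hy)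
  | fn f as ha _ ih => exact .fn (A := A.sub s) f as ha ih

theorem isIsoMap_sub {A B : Str L} {s : List ℕ} {h : ℕ → ℕ}
    (hs : TupleIn A s) (hh : IsEmbMap (A.sub s) B h) :
    IsIsoMap (A.sub s) (B.sub (s.map h)) h := by
  have hc : ∀ x, InClosure A s x → InClosure B (s.map h) (h x) := fun x hx =>
    hh.closure (sub_closure (InClosure.self hs) hx)
  refine ⟨⟨hc, hh.2.1, fun r as has => ?_, hh.2.2.2⟩, fun y hy => ?_⟩
  · rw [hh.2.2.1 r as has]
    refine ⟨fun h => ⟨h, fun y hy => ?_⟩, fun h => h.1⟩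
    obtain ⟨x, hx, rfl⟩ := List.mem_map.1 hy
    exact hc x (has x hx)
  · have hy' : InClosure B (s.map h) y := hy
    clear hy
    induction hy' with
    | base hy _ =>
      obtain ⟨x, hx, rfl⟩ := List.mem_map.1 hy
      exact ⟨x, .base hx (hs x hx), rfl⟩
    | fn f bs hb _ ih =>
      choose! k hk hk' using ih
      have hka : TupleIn (A.sub s) (bs.map k) := fun x hx => by
        obtain ⟨y, hy, rfl⟩ := List.mem_map.1 hx
        exact hk y hy
      have hl : L.funArity f = some (bs.map k).length := by simpa using hb
      refine ⟨A.fn f (bs.map k), (A.sub s).fn_mem f _ hl hka, ?_⟩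
      refine (hh.2.2.2 f _ hl hka).trans ?_
      rw [List.map_map]
      congr 1
      conv_rhs => rw [← List.map_id bs]
      exact map_congr_mem fun y hy => hk' y hy

theorem IsIsoMap.isEmbMap_sub {A B : Str L} {as bs : List ℕ} {h : ℕ → ℕ}
    (hh : IsIsoMap (A.sub as) (B.sub bs) h) : IsEmbMap (A.sub as) B h := by
  refine ⟨fun x hx => (hh.1.1 x hx).mem_dom, hh.1.2.1, fun r cs hcs => ?_, hh.1.2.2.2⟩
  rw [hh.1.2.2.1 r cs hcs]
  exact ⟨fun h => h.1, fun h => ⟨h, hh.1.tupleIn hcs⟩⟩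

theorem IsIsoMap.exists_inv {A B : Str L} {h : ℕ → ℕ} (hh : IsIsoMap A B h) :
    ∃ k, IsIsoMap B A k ∧ ∀ x ∈ A.dom, k (h x) = x := by
  have h2 := hh.2
  choose! k hk hk' using h2
  have hkh : ∀ x ∈ A.dom, k (h x) = x := fun x hx =>
    hh.1.2.1 _ (hk _ (hh.1.1 x hx)) _ hx (hk' _ (hh.1.1 x hx))
  have ht : ∀ bs, TupleIn B bs → TupleIn A (bs.map k) ∧ (bs.map k).map h = bs := by
    intro bs hbs
    refine ⟨fun x hx => ?_, ?_⟩
    · obtain ⟨y, hy, rfl⟩ := List.mem_map.1 hx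
      exact hk y (hbs y hy)
    · rw [List.map_map]
      conv_rhs => rw [← List.map_id bs]
      exact map_congr_mem fun y hy => hk' y (hbs y hy)
  refine ⟨k, ⟨⟨hk, fun x hx y hy e => ?_, fun r bs hbs => ?_, fun f bs hf hbs => ?_⟩,
    fun x hx => ⟨h x, hh.1.1 x hx, hkh x hx⟩⟩, hkh⟩
  · rw [← hk' x hx, ← hk' y hy, e]
  · rw [hh.1.2.2.1 r _ (ht bs hbs).1, (ht bs hbs).2]
  · have hl : L.funArity f = some (bs.map k).length := by simpa using hf
    have := hh.1.2.2.2 f _ hl (ht bs hbs).1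
    rw [(ht bs hbs).2] at this
    rw [← this]
    exact hkh _ (A.fn_mem f _ hl (ht bs hbs).1)

namespace Isom

variable {A B C : Str L}

theorem refl (A : Str L) : Isom A A := ⟨_, IsEmbMap.id, fun y hy => ⟨y, hy, rfl⟩⟩

theorem symm (h : Isom A B) : Isom B A := by
  obtain ⟨h, hh⟩ := h
  obtain ⟨k, hk, _⟩ := hh.exists_inv
  exact ⟨k, hk⟩

theorem trans (h : Isom A B) (h' : Isom B C) : Isom A C := by
  obtain ⟨h, hh⟩ := h
  obtain ⟨k, hk⟩ := h'
  refine ⟨_, hk.1.comp hh.1, fun z hz => ?_⟩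
  obtain ⟨y, hy, rfl⟩ := hk.2 z hz
  obtain ⟨x, hx, rfl⟩ := hh.2 y hy
  exact ⟨x, hx, rfl⟩

end Isom

namespace ClSim

variable {A B C : Str L} {as bs cs : List ℕ}

theorem isom (h : ClSim A as B bs) : Isom (A.sub as) (B.sub bs) := by
  obtain ⟨h, _, hh⟩ := h
  exact ⟨h, hh⟩

theorem of_emb {h : ℕ → ℕ} (hh : IsEmbMap A B h) (has : TupleIn A as) :
    ClSim A as B (as.map h) := ⟨h, rfl, isIsoMap_sub has (hh.sub as)⟩

theorem refl (has : TupleIn A as) : ClSim A as A as := by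
  simpa using of_emb IsEmbMap.id has

theorem exists_emb (h : ClSim A as B bs) :
    ∃ h, as.map h = bs ∧ IsEmbMap (A.sub as) B h := by
  obtain ⟨h, e, hh⟩ := h
  exact ⟨h, e, hh.isEmbMap_sub⟩

theorem symm (has : TupleIn A as) (h : ClSim A as B bs) : ClSim B bs A as := by
  obtain ⟨h, rfl, hh⟩ := h
  obtain ⟨k, hk, hkh⟩ := hh.exists_inv
  refine ⟨k, ?_, hk⟩
  rw [List.map_map]
  conv_rhs => rw [← List.map_id as]
  exact map_congr_mem fun x hx => hkh x (.base hx (has x hx))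

theorem trans (h : ClSim A as B bs) (h' : ClSim B bs C cs) : ClSim A as C cs := by
  obtain ⟨h, rfl, hh⟩ := h
  obtain ⟨k, rfl, hk⟩ := h'
  refine ⟨fun x => k (h x), by simp, hk.1.comp hh.1, fun z hz => ?_⟩
  obtain ⟨y, hy, rfl⟩ := hk.2 z hz
  obtain ⟨x, hx, rfl⟩ := hh.2 y hy
  exact ⟨x, hx, rfl⟩

/-- Restriction of `ClSim` to tuples of elements of the generated substructures. -/
theorem of_sub_emb {h : ℕ → ℕ} (hh : IsEmbMap (A.sub as) B h) {cs : List ℕ}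
    (hcs : ∀ x ∈ cs, InClosure A as x) : ClSim A cs B (cs.map h) := by
  refine ⟨h, rfl, isIsoMap_sub (TupleIn.of_closure hcs) ?_⟩
  have hc : ∀ x, InClosure A cs x → InClosure A as x := fun x hx => hx.trans hcs
  refine ⟨fun x hx => hh.1 x (hc x hx), fun x hx y hy => hh.2.1 x (hc x hx) y (hc y hy),
    fun r ds hds => ?_, fun f ds hf hds => hh.2.2.2 f ds hf fun x hx => hc x (hds x hx)⟩
  rw [← hh.2.2.1 r ds fun x hx => hc x (hds x hx)]
  exact ⟨fun h => ⟨h.1, fun x hx => hc x (h.2 x hx)⟩, fun h => ⟨h.1, hds⟩⟩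

theorem map_getD (has : TupleIn A as) (h : ClSim A as B bs) {I : List ℕ}
    (hI : ∀ i ∈ I, i < as.length) :
    ClSim A (I.map fun i => as.getD i 0) B (I.map fun i => bs.getD i 0) := by
  obtain ⟨k, rfl, hk⟩ := h.exists_emb
  have e : (I.map fun i => (as.map k).getD i 0) = (I.map fun i => as.getD i 0).map k := by
    rw [List.map_map]
    refine map_congr_mem fun i hi => ?_
    simp [List.getElem?_eq_getElem (hI i hi)]
  rw [e]
  refine of_sub_emb hk fun x hx => ?_
  obtain ⟨i, hi, rfl⟩ := List.mem_map.1 hx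
  refine InClosure.self has _ ?_
  rw [List.getD_eq_getElem _ _ (hI i hi)]
  exact List.getElem_mem _

theorem getD_inj (has : TupleIn A as) (h : ClSim A as B bs) {i j : ℕ} (hi : i < as.length)
    (hj : j < as.length) : as.getD i 0 = as.getD j 0 ↔ bs.getD i 0 = bs.getD j 0 := by
  obtain ⟨h, rfl, hh⟩ := h.exists_emb
  simp only [List.getD_eq_getElem?_getD, List.getElem?_map, List.getElem?_eq_getElem hi,
    List.getElem?_eq_getElem hj, Option.map_some, Option.getD_some]
  exact ⟨fun e => e ▸ rfl, fun e => hh.2.1 _ (InClosure.self has _ (List.getElem_mem _)) _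
    (InClosure.self has _ (List.getElem_mem _)) e⟩

theorem rel_iff (has : TupleIn A as) (h : ClSim A as B bs) (r : ℕ) :
    A.rel r as ↔ B.rel r bs := by
  obtain ⟨h, rfl, hh⟩ := h.exists_emb
  rw [← hh.2.2.1 r as (InClosure.self has)]
  exact ⟨fun h => ⟨h, InClosure.self has⟩, fun h => h.1⟩

theorem fn_iff {x y : ℕ} (has : TupleIn A (as ++ [x])) (h : ClSim A (as ++ [x]) B (bs ++ [y]))
    {f : ℕ} (hf : L.funArity f = some as.length) : A.fn f as = x ↔ B.fn f bs = y := by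
  obtain ⟨k, e, hh⟩ := h.exists_emb
  rw [List.map_append, List.map_cons, List.map_nil] at e
  obtain ⟨rfl, e⟩ := List.append_inj' e rfl
  obtain rfl : k x = y := by simpa using e
  have has' : TupleIn (A.sub (as ++ [x])) as := fun z hz =>
    InClosure.self has z (List.mem_append_left _ hz)
  rw [← hh.2.2.2 f as hf has']
  exact ⟨fun e => e ▸ rfl, fun e => hh.2.1 _ ((A.sub _).fn_mem f as hf has') _
    (InClosure.self has x (by simp)) e⟩

end ClSim

/-- The graph of the (unique) candidate for a map `A.sub as → B.sub bs` sending `as` to `bs`. -/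
inductive PairClosure (A B : Str L) (ps : List (ℕ × ℕ)) : ℕ × ℕ → Prop
  | base {p : ℕ × ℕ} : p ∈ ps → PairClosure A B ps p
  | fn (f : ℕ) (qs : List (ℕ × ℕ)) : L.funArity f = some qs.length →
      (∀ q ∈ qs, PairClosure A B ps q) →
      PairClosure A B ps (A.fn f (qs.map Prod.fst), B.fn f (qs.map Prod.snd))

namespace PairClosure

variable {A B : Str L} {ps : List (ℕ × ℕ)}

theorem exists_of_mem {x : ℕ} (hx : InClosure A (ps.map Prod.fst) x) :
    ∃ y, PairClosure A B ps (x, y) := by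
  induction hx with
  | base hx _ =>
    obtain ⟨p, hp, rfl⟩ := List.mem_map.1 hx
    exact ⟨p.2, .base hp⟩
  | fn f as ha _ ih =>
    choose! k hk using ih
    refine ⟨B.fn f (as.map k), ?_⟩
    have := PairClosure.fn (A := A) (B := B) (ps := ps) f (as.map fun x => (x, k x))
      (by simpa using ha) (by simpa using hk)
    simpa [List.map_map, Function.comp_def] using this

theorem snd_mem (hb : TupleIn B (ps.map Prod.snd)) {p : ℕ × ℕ} (hp : PairClosure A B ps p) :
    InClosure B (ps.map Prod.snd) p.2 := by
  induction hp with
  | base hp => exact InClosure.self hb _ (List.mem_map_of_mem hp)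
  | fn f qs hf _ ih =>
    refine .fn f _ (by simpa using hf) fun x hx => ?_
    obtain ⟨q, hq, rfl⟩ := List.mem_map.1 hx
    exact ih q hq

theorem of_clSim {as : List ℕ} {h : ℕ → ℕ} (has : TupleIn A as) (hh : IsEmbMap (A.sub as) B h)
    {p : ℕ × ℕ} (hp : PairClosure A B (as.map fun x => (x, h x)) p) :
    InClosure A as p.1 ∧ p.2 = h p.1 := by
  induction hp with
  | base hp =>
    obtain ⟨x, hx, rfl⟩ := List.mem_map.1 hp
    exact ⟨InClosure.self has x hx, rfl⟩
  | fn f qs hf _ ih =>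
    have ht : TupleIn (A.sub as) (qs.map Prod.fst) := fun x hx => by
      obtain ⟨q, hq, rfl⟩ := List.mem_map.1 hx
      exact (ih q hq).1
    have hl : L.funArity f = some (qs.map Prod.fst).length := by simpa using hf
    refine ⟨(A.sub as).fn_mem f _ hl ht, ?_⟩
    refine Eq.trans ?_ (hh.2.2.2 f _ hl ht).symm
    rw [List.map_map]
    show B.fn f _ = B.fn f _
    congr 1
    exact map_congr_mem fun q hq => (ih q hq).2

/-- A criterion for `ClSim` in terms of finitely many pairs at a time. -/
theorem clSim (ha : TupleIn A (ps.map Prod.fst)) (hb : TupleIn B (ps.map Prod.snd))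
    (h : ∀ qs : List (ℕ × ℕ), (∀ q ∈ qs, PairClosure A B ps q) →
      (∀ p ∈ qs, ∀ q ∈ qs, p.1 = q.1 ↔ p.2 = q.2) ∧
      ∀ r, A.rel r (qs.map Prod.fst) ↔ B.rel r (qs.map Prod.snd)) :
    ClSim A (ps.map Prod.fst) B (ps.map Prod.snd) := by
  have huniq : ∀ p q : ℕ × ℕ, PairClosure A B ps p → PairClosure A B ps q →
      (p.1 = q.1 ↔ p.2 = q.2) := fun p q hp hq =>
    (h [p, q] (by simp [hp, hq])).1 p (by simp) q (by simp)
  have hex := fun x (hx : InClosure A (ps.map Prod.fst) x) => exists_of_mem (B := B) hx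
  choose! k hk using hex
  have hps : ∀ p ∈ ps, k p.1 = p.2 := fun p hp =>
    (huniq (p.1, k p.1) p (hk _ (InClosure.self ha _ (List.mem_map_of_mem hp))) (.base hp)).1 rfl
  have hkemb : IsEmbMap (A.sub (ps.map Prod.fst)) B k := by
    refine ⟨fun x hx => (snd_mem hb (hk x hx)).mem_dom, fun x hx y hy e =>
      (huniq _ _ (hk x hx) (hk y hy)).2 e, fun r as has => ?_, fun f as hf has => ?_⟩
    · have := (h (as.map fun x => (x, k x)) (by
        intro q hq
        obtain ⟨x, hx, rfl⟩ := List.mem_map.1 hq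
        exact hk x (has x hx))).2 r
      simp only [List.map_map, Function.comp_def, List.map_id'] at this
      rw [← this]
      exact ⟨fun h => h.1, fun h => ⟨h, has⟩⟩
    · have := PairClosure.fn (A := A) (B := B) (ps := ps) f (as.map fun x => (x, k x))
        (by simpa using hf) (by
          intro q hq
          obtain ⟨x, hx, rfl⟩ := List.mem_map.1 hq
          exact hk x (has x hx))
      simp only [List.map_map, Function.comp_def, List.map_id'] at this
      exact (huniq _ _ (hk _ ((A.sub _).fn_mem f as hf has)) this).1 rfl
  have e : (ps.map Prod.fst).map k = ps.map Prod.snd := by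
    rw [List.map_map]
    exact map_congr_mem hps
  have := isIsoMap_sub ha hkemb
  rw [e] at this
  exact ⟨k, e, this⟩

end PairClosure

/-! ### Generic chains and their limits -/

/-- A sequence of tuples in members of the age, each extending the previous one up to `ClSim`,
that realizes every one-point extension available in the age. -/
structure GenericChain (K : CompAge L) where
  idx : ℕ → ℕ
  tup : ℕ → List ℕ
  tup_mem : ∀ n, TupleIn (K.str (idx n)) (tup n)
  mono : ∀ n, (tup n).length ≤ (tup (n + 1)).length
  coh : ∀ n, ClSim (K.str (idx n)) (tup n) (K.str (idx (n + 1)))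
    ((tup (n + 1)).take (tup n).length)
  inj : ∀ n i j, i < (tup n).length → j < (tup n).length →
    (tup n).getD i 0 = (tup n).getD j 0 → i = j
  often : ∀ n (I : List ℕ) k (d : List ℕ) y, ∃ m, n ≤ m ∧ ((∀ i ∈ I, i < (tup m).length) →
    TupleIn (K.str k) (d ++ [y]) →
    ClSim (K.str (idx m)) (I.map fun i => (tup m).getD i 0) (K.str k) d →
    ∃ m', m ≤ m' ∧ ∃ j < (tup m').length,
      ClSim (K.str (idx m')) ((I ++ [j]).map fun i => (tup m').getD i 0) (K.str k) (d ++ [y]))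
  start : ∀ k, ClSim (K.str (idx 0)) [] (K.str k) []

namespace GenericChain

variable {K : CompAge L} (S : GenericChain K)

/-- The `n`-th structure of the chain. -/
def str (n : ℕ) : Str L := K.str (S.idx n)

/-- The element of the `n`-th structure named by `i`. -/
def val (n i : ℕ) : ℕ := (S.tup n).getD i 0

/-- All members of `I` name elements at stage `n`. -/
def In (n : ℕ) (I : List ℕ) : Prop := ∀ i ∈ I, i < (S.tup n).length

theorem len_mono : Monotone fun n => (S.tup n).length := monotone_nat_of_le_succ S.mono

theorem In.mono {S : GenericChain K} {n m : ℕ} {I : List ℕ} (h : S.In n I) (hnm : n ≤ m) :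
    S.In m I := fun i hi => (h i hi).trans_le (S.len_mono hnm)

theorem val_mem {n i : ℕ} (hi : i < (S.tup n).length) : S.val n i ∈ (S.str n).dom := by
  refine S.tup_mem n _ ?_
  rw [val, List.getD_eq_getElem _ _ hi]
  exact List.getElem_mem _

theorem map_val_mem {n : ℕ} {I : List ℕ} (hI : S.In n I) :
    TupleIn (S.str n) (I.map (S.val n)) := fun x hx => by
  obtain ⟨i, hi, rfl⟩ := List.mem_map.1 hx
  exact S.val_mem (hI i hi)

theorem clSim_map_val {n m : ℕ} {I : List ℕ} (hI : S.In n I) (hnm : n ≤ m) :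
    ClSim (S.str n) (I.map (S.val n)) (S.str m) (I.map (S.val m)) := by
  induction m, hnm using Nat.le_induction with
  | base => exact .refl (S.map_val_mem hI)
  | succ m hnm ih =>
    have hI' := hI.mono hnm
    have := (S.coh m).map_getD (S.tup_mem m) hI'
    refine ih.trans ?_
    have e : (I.map fun i => ((S.tup (m + 1)).take (S.tup m).length).getD i 0) =
        I.map (S.val (m + 1)) := map_congr_mem fun i hi => by
      simp [val, hI' i hi]
    rwa [e] at this

theorem rich {n : ℕ} {I : List ℕ} {k : ℕ} {d : List ℕ} {y : ℕ} (hI : S.In n I)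
    (hd : TupleIn (K.str k) (d ++ [y])) (h : ClSim (S.str n) (I.map (S.val n)) (K.str k) d) :
    ∃ m, n ≤ m ∧ ∃ j < (S.tup m).length,
      ClSim (S.str m) ((I ++ [j]).map (S.val m)) (K.str k) (d ++ [y]) := by
  obtain ⟨m, hm, hr⟩ := S.often n I k d y
  have hc := (S.clSim_map_val hI hm).symm (S.map_val_mem hI)
  obtain ⟨m', hm', hj⟩ := hr (hI.mono hm) hd (hc.trans h)
  exact ⟨m', hm.trans hm', hj⟩

/-- The limit of a generic chain. -/
noncomputable def limit : Str L where
  dom := { j | ∃ n, j < (S.tup n).length }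
  rel r as := ∃ n, S.In n as ∧ (S.str n).rel r (as.map (S.val n))
  fn f as :=
    if h : ∃ j n, j < (S.tup n).length ∧ S.In n as ∧
        (S.str n).fn f (as.map (S.val n)) = S.val n j then h.choose
    else if h : ∃ j n, j < (S.tup n).length then h.choose else 0
  rel_valid r as := by
    rintro ⟨n, hn, h⟩
    refine ⟨by simpa using ((S.str n).rel_valid r _ h).1, fun x hx => ⟨n, hn x hx⟩⟩
  fn_mem f as ha has := by
    split_ifs with h h'
    · obtain ⟨n, hn, _⟩ := h.choose_spec
      exact ⟨n, hn⟩
    · exact h'.choose_spec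
    · exfalso
      have hn : ∃ n, S.In n as := by
        cases as with
        | nil => exact ⟨0, fun _ => by simp⟩
        | cons a as => exact absurd ⟨a, has a (by simp)⟩ h'
      obtain ⟨n, hn⟩ := hn
      have hm := S.map_val_mem hn
      obtain ⟨m, _, j, hj, _⟩ := S.rich (k := S.idx n)
        (y := (S.str n).fn f (as.map (S.val n))) hn
        (fun x hx => by
          rcases List.mem_append.1 hx with hx | hx
          · exact hm x hx
          · rw [List.mem_singleton.1 hx]
            exact (S.str n).fn_mem f _ (by simpa using ha) hm) (.refl hm)
      exact h' ⟨j, m, hj⟩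

theorem eventually_in {I : List ℕ} (hI : TupleIn S.limit I) :
    ∃ n, ∀ m, n ≤ m → S.In m I := by
  induction I with
  | nil => exact ⟨0, fun m _ i hi => by simp at hi⟩
  | cons a I ih =>
    obtain ⟨n, hn⟩ := ih fun x hx => hI x (List.mem_cons_of_mem _ hx)
    obtain ⟨n', hn'⟩ := hI a (by simp)
    refine ⟨max n n', fun m hm i hi => ?_⟩
    rcases List.mem_cons.1 hi with rfl | hi
    · exact hn'.trans_le (S.len_mono ((le_max_right _ _).trans hm))
    · exact hn m ((le_max_left _ _).trans hm) i hi

theorem In.tupleIn {S : GenericChain K} {n : ℕ} {I : List ℕ} (h : S.In n I) :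
    TupleIn S.limit I := fun i hi => ⟨n, h i hi⟩

theorem rel_iff {n : ℕ} {as : List ℕ} (has : S.In n as) (r : ℕ) :
    S.limit.rel r as ↔ (S.str n).rel r (as.map (S.val n)) := by
  refine ⟨fun ⟨m, hm, h⟩ => ?_, fun h => ⟨n, has, h⟩⟩
  rw [(S.clSim_map_val has (le_max_left n m)).rel_iff (S.map_val_mem has)]
  rwa [(S.clSim_map_val hm (le_max_right n m)).rel_iff (S.map_val_mem hm)] at h

theorem fn_iff_of_le {n m : ℕ} {as : List ℕ} {j f : ℕ} (has : S.In n as)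
    (hf : L.funArity f = some as.length) (hj : j < (S.tup n).length) (hnm : n ≤ m) :
    (S.str n).fn f (as.map (S.val n)) = S.val n j ↔
      (S.str m).fn f (as.map (S.val m)) = S.val m j := by
  have hI : S.In n (as ++ [j]) := fun i hi => by
    rcases List.mem_append.1 hi with hi | hi
    · exact has i hi
    · rwa [List.mem_singleton.1 hi]
  have h := S.clSim_map_val hI hnm
  have h' := S.map_val_mem hI
  rw [List.map_append, List.map_append] at h
  rw [List.map_append] at h'
  exact ClSim.fn_iff h' h (by simpa using hf)

theorem fn_iff {n : ℕ} {as : List ℕ} {j f : ℕ} (has : S.In n as)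
    (hf : L.funArity f = some as.length) (hj : j < (S.tup n).length) :
    S.limit.fn f as = j ↔ (S.str n).fn f (as.map (S.val n)) = S.val n j := by
  have huniq : ∀ j j' n n', j < (S.tup n).length → S.In n as →
      (S.str n).fn f (as.map (S.val n)) = S.val n j → j' < (S.tup n').length → S.In n' as →
      (S.str n').fn f (as.map (S.val n')) = S.val n' j' → j = j' := by
    intro j j' n n' hj hn h hj' hn' h'
    rw [S.fn_iff_of_le hn hf hj (le_max_left n n')] at h
    rw [S.fn_iff_of_le hn' hf hj' (le_max_right n n')] at h'
    exact S.inj (max n n') j j' (hj.trans_le (S.len_mono (le_max_left n n')))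
      (hj'.trans_le (S.len_mono (le_max_right n n'))) (h.symm.trans h')
  have hm := S.map_val_mem has
  have hex : ∃ j n, j < (S.tup n).length ∧ S.In n as ∧
        (S.str n).fn f (as.map (S.val n)) = S.val n j := by
    have hd : TupleIn (S.str n) (as.map (S.val n) ++ [(S.str n).fn f (as.map (S.val n))]) :=
      fun x hx => by
        rcases List.mem_append.1 hx with hx | hx
        · exact hm x hx
        · rw [List.mem_singleton.1 hx]
          exact (S.str n).fn_mem f _ (by simpa using hf) hm
    obtain ⟨m, hnm, j, hj, h⟩ := S.rich (k := S.idx n) has hd (.refl hm)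
    have hI : S.In m (as ++ [j]) := fun i hi => by
      rcases List.mem_append.1 hi with hi | hi
      · exact has.mono hnm i hi
      · rwa [List.mem_singleton.1 hi]
    have h' := S.map_val_mem hI
    rw [List.map_append] at h h'
    exact ⟨j, m, hj, has.mono hnm, (h.fn_iff h' (by simpa using hf)).2 rfl⟩
  have hval : S.limit.fn f as = hex.choose := dif_pos hex
  obtain ⟨n', h1, h2, h3⟩ := hex.choose_spec
  rw [hval]
  refine ⟨fun e => ?_, fun h => huniq _ _ _ _ h1 h2 h3 hj has h⟩
  rw [S.fn_iff_of_le has hf hj (le_max_left n n')]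
  rw [S.fn_iff_of_le h2 hf h1 (le_max_right n n'), e] at h3
  exact h3

theorem fn_mem_limit {f : ℕ} {as : List ℕ} (hf : L.funArity f = some as.length)
    (has : TupleIn S.limit as) : S.limit.fn f as ∈ S.limit.dom := S.limit.fn_mem f as hf has

theorem pairClosure_stage {n : ℕ} {as : List ℕ} (has : S.In n as) {p : ℕ × ℕ}
    (hp : PairClosure S.limit (S.str n) (as.map fun i => (i, S.val n i)) p) :
    ∃ m₀, ∀ m, m₀ ≤ m → p.1 < (S.tup m).length ∧
      PairClosure (S.str m) (S.str n) (as.map fun i => (S.val m i, S.val n i))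
        (S.val m p.1, p.2) := by
  induction hp with
  | base hp =>
    obtain ⟨i, hi, rfl⟩ := List.mem_map.1 hp
    exact ⟨n, fun m hm => ⟨has.mono hm i hi, .base (List.mem_map_of_mem hi)⟩⟩
  | fn f qs hf _ ih =>
    choose! k hk using ih
    have hq : ∀ q ∈ qs, ∀ m, (qs.map k).sum ≤ m → q.1 < (S.tup m).length ∧
        PairClosure (S.str m) (S.str n) (as.map fun i => (S.val m i, S.val n i))
          (S.val m q.1, q.2) := fun q hq m hm =>
      hk q hq m ((List.single_le_sum (by simp) _ (List.mem_map_of_mem hq)).trans hm)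
    have hin : ∀ m, (qs.map k).sum ≤ m → S.In m (qs.map Prod.fst) := fun m hm i hi => by
      obtain ⟨q, hq', rfl⟩ := List.mem_map.1 hi
      exact (hq q hq' m hm).1
    have hl : L.funArity f = some (qs.map Prod.fst).length := by simpa using hf
    obtain ⟨n', hn'⟩ := S.fn_mem_limit hl (hin _ le_rfl).tupleIn
    refine ⟨max (qs.map k).sum n', fun m hm => ?_⟩
    have h1 := (le_max_left _ _).trans hm
    have hlt := hn'.trans_le (S.len_mono ((le_max_right _ _).trans hm))
    refine ⟨hlt, ?_⟩
    have := PairClosure.fn (A := S.str m) (B := S.str n)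
      (ps := as.map fun i => (S.val m i, S.val n i)) f (qs.map fun q => (S.val m q.1, q.2))
      (by simpa using hf) (fun q' hqm => by
        obtain ⟨q, hq', rfl⟩ := List.mem_map.1 hqm
        exact (hq q hq' m h1).2)
    simp only [List.map_map, Function.comp_def] at this
    rw [← (S.fn_iff (hin m h1) hl hlt).1 rfl, List.map_map]
    exact this

/-- A tuple of the limit looks like its value at any stage. -/
theorem clSim_stage {n : ℕ} {as : List ℕ} (has : S.In n as) :
    ClSim S.limit as (S.str n) (as.map (S.val n)) := by
  have key := PairClosure.clSim (A := S.limit) (B := S.str n)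
    (ps := as.map fun i => (i, S.val n i))
    (by simpa [Function.comp_def] using has.tupleIn)
    (by simpa [Function.comp_def] using S.map_val_mem has) ?_
  · simpa [Function.comp_def] using key
  intro qs hqs
  have := fun q hq => S.pairClosure_stage has (hqs q hq)
  choose! k hk using this
  have hq : ∀ q ∈ qs, ∀ m, (qs.map k).sum ≤ m → q.1 < (S.tup m).length ∧
      PairClosure (S.str m) (S.str n) (as.map fun i => (S.val m i, S.val n i))
        (S.val m q.1, q.2) := fun q hq m hm =>
    hk q hq m ((List.single_le_sum (by simp) _ (List.mem_map_of_mem hq)).trans hm)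
  obtain ⟨m, hm1, hm2⟩ : ∃ m, (qs.map k).sum ≤ m ∧ n ≤ m :=
    ⟨_, le_max_left _ _, le_max_right _ n⟩
  have hasm := S.map_val_mem (has.mono hm2)
  obtain ⟨h, e, hh⟩ := ((S.clSim_map_val has hm2).symm (S.map_val_mem has)).exists_emb
  have e' : (as.map fun i => (S.val m i, S.val n i)) =
      (as.map (S.val m)).map fun x => (x, h x) := by
    rw [List.map_map] at e ⊢
    refine map_congr_mem fun i hi => ?_
    rw [← List.map_inj_left.1 e i hi]
    rfl
  have hqh : ∀ q ∈ qs, InClosure (S.str m) (as.map (S.val m)) (S.val m q.1) ∧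
      q.2 = h (S.val m q.1) := fun q hq' => by
    have := (hq q hq' m hm1).2
    rw [e'] at this
    exact PairClosure.of_clSim hasm hh this
  refine ⟨fun p hp q hq' => ?_, fun r => ?_⟩
  · rw [(hqh p hp).2, (hqh q hq').2]
    refine ⟨fun e => by rw [e], fun e => S.inj m _ _ (hq p hp m hm1).1 (hq q hq' m hm1).1 ?_⟩
    exact hh.2.1 _ (hqh p hp).1 _ (hqh q hq').1 e
  · have hin : S.In m (qs.map Prod.fst) := fun i hi => by
      obtain ⟨q, hq', rfl⟩ := List.mem_map.1 hi
      exact (hq q hq' m hm1).1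
    have hcl : TupleIn ((S.str m).sub (as.map (S.val m))) ((qs.map Prod.fst).map (S.val m)) :=
      fun x hx => by
        simp only [List.map_map, List.mem_map, Function.comp_apply] at hx
        obtain ⟨q, hq', rfl⟩ := hx
        exact (hqh q hq').1
    have e2 : qs.map Prod.snd = ((qs.map Prod.fst).map (S.val m)).map h := by
      simp only [List.map_map]
      exact map_congr_mem fun q hq' => (hqh q hq').2
    rw [S.rel_iff hin, e2, ← hh.2.2.1 r _ hcl]
    exact ⟨fun h => ⟨h, hcl⟩, fun h => h.1⟩

theorem clSim_limit_iff {n : ℕ} {as bs : List ℕ} (has : S.In n as) (hbs : S.In n bs) :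
    ClSim S.limit as S.limit bs ↔
      ClSim (S.str n) (as.map (S.val n)) (S.str n) (bs.map (S.val n)) := by
  have h1 := S.clSim_stage has
  have h2 := S.clSim_stage hbs
  exact ⟨fun h => ((h1.symm has.tupleIn).trans h).trans h2,
    fun h => (h1.trans h).trans (h2.symm hbs.tupleIn)⟩

theorem extend {as d : List ℕ} {k y : ℕ} (has : TupleIn S.limit as)
    (hd : TupleIn (K.str k) (d ++ [y])) (h : ClSim S.limit as (K.str k) d) :
    ∃ j ∈ S.limit.dom, ClSim S.limit (as ++ [j]) (K.str k) (d ++ [y]) := by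
  obtain ⟨n, hn⟩ := S.eventually_in has
  have hn := hn n le_rfl
  obtain ⟨m, hnm, j, hj, hc⟩ := S.rich hn hd
    (((S.clSim_stage hn).symm has).trans h)
  have hI : S.In m (as ++ [j]) := fun i hi => by
    rcases List.mem_append.1 hi with hi | hi
    · exact hn.mono hnm i hi
    · rwa [List.mem_singleton.1 hi]
  exact ⟨j, ⟨m, hj⟩, (S.clSim_stage hI).trans hc⟩

theorem extend_limit {as bs : List ℕ} {c : ℕ} (has : TupleIn S.limit as)
    (hbs : TupleIn S.limit bs) (hc : c ∈ S.limit.dom) (h : ClSim S.limit as S.limit bs) :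
    ∃ j ∈ S.limit.dom, ClSim S.limit (as ++ [j]) S.limit (bs ++ [c]) := by
  have hbc : TupleIn S.limit (bs ++ [c]) := fun x hx => by
    rcases List.mem_append.1 hx with hx | hx
    · exact hbs x hx
    · rwa [List.mem_singleton.1 hx]
  obtain ⟨n, hn⟩ := S.eventually_in hbc
  have hn := hn n le_rfl
  have hn' : S.In n bs := fun i hi => hn i (List.mem_append_left _ hi)
  have h1 := S.clSim_stage hn
  have h2 := S.map_val_mem hn
  rw [List.map_append] at h1 h2
  obtain ⟨j, hj, hjc⟩ := S.extend has h2 (h.trans (S.clSim_stage hn'))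
  exact ⟨j, hj, hjc.trans (h1.symm hbc)⟩

theorem exists_clSim (k : ℕ) (d : List ℕ) (hd : TupleIn (K.str k) d) :
    ∃ as, TupleIn S.limit as ∧ ClSim S.limit as (K.str k) d := by
  induction d using List.reverseRecOn with
  | nil =>
    refine ⟨[], fun x hx => by simp at hx, ?_⟩
    exact (S.clSim_stage (n := 0) (as := []) fun x hx => by simp at hx).trans (S.start k)
  | append_singleton d y ih =>
    obtain ⟨as, has, h⟩ := ih fun x hx => hd x (List.mem_append_left _ hx)
    obtain ⟨j, hj, hjc⟩ := S.extend has hd h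
    refine ⟨as ++ [j], fun x hx => ?_, hjc⟩
    rcases List.mem_append.1 hx with hx | hx
    · exact has x hx
    · rwa [List.mem_singleton.1 hx]

end GenericChain

theorem CompAge.mem_cls (K : CompAge L) (i : ℕ) : K.str i ∈ K.cls := ⟨i, .refl _⟩

/-- A structure generated by a tuple is isomorphic to the substructure generated by it. -/
theorem isom_sub_of_generates {A : Str L} {s : List ℕ}
    (h : ∀ x, x ∈ A.dom ↔ InClosure A s x) : Isom A (A.sub s) := by
  refine ⟨fun x => x, ⟨fun x hx => (h x).1 hx, fun _ _ _ _ e => e, fun r as has => ?_,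
    fun f as _ _ => ?_⟩, fun y hy => ⟨y, (h y).2 hy, rfl⟩⟩
  · rw [List.map_id']
    exact ⟨fun hr => ⟨hr, fun x hx => (h x).1 (has x hx)⟩, fun hr => hr.1⟩
  · rw [List.map_id']; rfl

theorem GenericChain.representsAgeOf {K : CompAge L} (S : GenericChain K) (hHP : HP K.cls) :
    RepresentsAgeOf K S.limit := by
  refine ⟨fun i => ?_, fun B ⟨as, has, hB⟩ => ?_⟩
  · obtain ⟨as, has, h⟩ := S.exists_clSim i (K.tup i) (K.tup_mem i)
    exact ⟨as, has, (isom_sub_of_generates (K.gen i)).trans h.isom.symm⟩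
  · obtain ⟨n, hn⟩ := S.eventually_in has
    have hn := hn n le_rfl
    obtain ⟨i, hi⟩ := hHP _ (K.mem_cls (S.idx n)) _ (S.map_val_mem hn)
    exact ⟨i, (hB.trans (S.clSim_stage hn).isom).trans hi⟩

/-! ### Embedding information as a decidable relation -/

/-- The relation coded by `EmbedInfo K`. -/
def CompAge.SimAt (K : CompAge L) (k₀ : ℕ) (b₀ : List ℕ) (k₁ : ℕ) (b₁ : List ℕ) : Prop :=
  TupleIn (K.str k₀) b₀ ∧ TupleIn (K.str k₁) b₁ ∧ ClSim (K.str k₀) b₀ (K.str k₁) b₁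

theorem CompAge.simAt_self {K : CompAge L} {k : ℕ} {b : List ℕ} :
    K.SimAt k b k b ↔ TupleIn (K.str k) b := ⟨fun h => h.1, fun h => ⟨h, h, .refl h⟩⟩

theorem CompAge.simAt_iff_encode (K : CompAge L) (q : ℕ × List ℕ × ℕ × List ℕ) :
    K.SimAt q.1 q.2.1 q.2.2.1 q.2.2.2 ↔ Encodable.encode q ∈ EmbedInfo K := by
  obtain ⟨k, b, k', b'⟩ := q
  constructor
  · exact fun ⟨h, h', h''⟩ => ⟨k, b, k', b', h, h', h'', rfl⟩
  · rintro ⟨l, c, l', c', h, h', h'', e⟩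
    have e' : Encodable.encode (k, b, k', b') = Encodable.encode (l, c, l', c') := e
    obtain ⟨rfl, rfl, rfl, rfl⟩ : k = l ∧ b = c ∧ k' = l' ∧ b' = c' := by
      simpa using Encodable.encode_injective e'
    exact ⟨h, h', h''⟩

theorem CompAge.decIn_simAt (K : CompAge L) : DecIn (EmbedInfo K)
    (fun q : ℕ × List ℕ × ℕ × List ℕ => K.SimAt q.1 q.2.1 q.2.2.1 q.2.2.2) :=
  (DecIn.oracle.comp (.of_primrec .encode)).of_iff K.simAt_iff_encode

theorem DecIn.simAt {α : Type*} [Primcodable α] (K : CompAge L) {f g : α → ℕ} {b c : α → List ℕ}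
    (hf : CompIn (EmbedInfo K) f) (hb : CompIn (EmbedInfo K) b) (hg : CompIn (EmbedInfo K) g)
    (hc : CompIn (EmbedInfo K) c) :
    DecIn (EmbedInfo K) (fun a => K.SimAt (f a) (b a) (g a) (c a)) :=
  K.decIn_simAt.comp (hf.pair (hb.pair (hg.pair hc)))

/-! ### One-point extensions -/

/-- The entries of `b` at the positions listed in `I`. -/
def select (b I : List ℕ) : List ℕ := I.map fun i => b.getD i 0

theorem select_append (b I J : List ℕ) : select b (I ++ J) = select b I ++ select b J :=
  List.map_append

theorem select_congr {b c I : List ℕ} (h : ∀ i ∈ I, b.getD i 0 = c.getD i 0) :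
    select b I = select c I := map_congr_mem h

theorem getD_take {b : List ℕ} {n i : ℕ} (h : i < n) : (b.take n).getD i 0 = b.getD i 0 := by
  simp [List.getD_eq_getElem?_getD, h]

theorem primrec_select : Primrec fun q : List ℕ × List ℕ => select q.1 q.2 :=
  Primrec.list_map .snd ((Primrec.list_getD 0).comp (Primrec.fst.comp .fst) .snd)

theorem CompAge.exists_extension {K : CompAge L} (hHP : HP K.cls) (hAP : AP K.cls) {k k₁ : ℕ}
    {b I d : List ℕ} {y : ℕ} (hb : TupleIn (K.str k) b) (hI : ∀ i ∈ I, i < b.length)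
    (hd : TupleIn (K.str k₁) (d ++ [y])) (h : ClSim (K.str k) (select b I) (K.str k₁) d) :
    ∃ k' b', b'.length = b.length + 1 ∧ TupleIn (K.str k') b' ∧
      K.SimAt k b k' (b'.take b.length) ∧
      K.SimAt k' (select b' (I ++ [b.length])) k₁ (d ++ [y]) := by
  have hbI : TupleIn (K.str k) (select b I) := fun x hx => by
    obtain ⟨i, hi, rfl⟩ := List.mem_map.1 hx
    refine hb _ ?_
    rw [List.getD_eq_getElem _ _ (hI i hi)]
    exact List.getElem_mem _
  have hd' : TupleIn (K.str k₁) d := fun x hx => hd x (List.mem_append_left _ hx)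
  obtain ⟨f, hf, hfe⟩ := (h.symm hbI).exists_emb
  obtain ⟨D, ⟨k', e, he⟩, g₀, g₁, hg₀, hg₁, hg⟩ := hAP _ (hHP _ (K.mem_cls k₁) d hd') _
    (K.mem_cls k) _ (K.mem_cls k₁) f (fun x => x) hfe (IsEmbMap.id.sub d)
  have h₀ := he.1.comp hg₀
  have h₁ := he.1.comp hg₁
  refine ⟨k', b.map (fun x => e (g₀ x)) ++ [e (g₁ y)], by simp, fun x hx => ?_, ?_, ?_⟩
  · rcases List.mem_append.1 hx with hx | hx
    · exact h₀.tupleIn hb x hx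
    · rw [List.mem_singleton.1 hx]
      exact h₁.1 y (hd y (by simp))
  · have : (b.map (fun x => e (g₀ x)) ++ [e (g₁ y)]).take b.length =
        b.map (fun x => e (g₀ x)) := List.take_left' (by simp)
    rw [this]
    exact ⟨hb, h₀.tupleIn hb, .of_emb h₀ hb⟩
  · have : select (b.map (fun x => e (g₀ x)) ++ [e (g₁ y)]) (I ++ [b.length]) =
        (d ++ [y]).map fun x => e (g₁ x) := by
      rw [select_append, List.map_append]
      congr 1
      · have e1 : select (b.map (fun x => e (g₀ x)) ++ [e (g₁ y)]) I =
            (select b I).map fun x => e (g₀ x) := by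
          rw [select, select, List.map_map]
          refine map_congr_mem fun i hi => ?_
          simp [List.getElem?_append, hI i hi]
        rw [e1, ← hf, List.map_map]
        exact map_congr_mem fun x hx => congrArg e (hg x (.base hx (hd' x hx)))
      · simp [select]
    rw [this]
    exact ⟨h₁.tupleIn hd, hd, (ClSim.of_emb h₁ hd).symm hd⟩

/-! ### The step of the construction -/

/-- A stage of the construction: an index and a tuple. -/
abbrev Stage := ℕ × List ℕ

/-- A requirement `(I, k, d, y)`: if the entries at positions `I` look like the tuple `d` of the
`k`-th structure, then some position has to look like `y` over them. -/
abbrev Requirement := List ℕ × ℕ × List ℕ × ℕ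

/-- The requirement applies to the stage and is not yet met. -/
def CompAge.Needs (K : CompAge L) (s : Stage) (r : Requirement) : Prop :=
  K.SimAt s.1 s.2 s.1 s.2 ∧ (∀ i ∈ r.1, i < s.2.length) ∧
    K.SimAt s.1 (select s.2 r.1) r.2.1 r.2.2.1 ∧
    K.SimAt r.2.1 (r.2.2.1 ++ [r.2.2.2]) r.2.1 (r.2.2.1 ++ [r.2.2.2]) ∧
    ¬ ∃ j < s.2.length, K.SimAt s.1 (select s.2 (r.1 ++ [j])) r.2.1 (r.2.2.1 ++ [r.2.2.2])

/-- The stage `s'` extends `s` by one entry meeting the requirement. -/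
def CompAge.Meets (K : CompAge L) (s : Stage) (r : Requirement) (s' : Stage) : Prop :=
  s'.2.length = s.2.length + 1 ∧ K.SimAt s'.1 s'.2 s'.1 s'.2 ∧
    K.SimAt s.1 s.2 s'.1 (s'.2.take s.2.length) ∧
    K.SimAt s'.1 (select s'.2 (r.1 ++ [s.2.length])) r.2.1 (r.2.2.1 ++ [r.2.2.2])

theorem CompAge.decIn_needs (K : CompAge L) :
    DecIn (EmbedInfo K) (fun q : Stage × Requirement => K.Needs q.1 q.2) := by
  have s1 : Primrec fun q : Stage × Requirement => q.1.1 := Primrec.fst.comp .fst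
  have s2 : Primrec fun q : Stage × Requirement => q.1.2 := Primrec.snd.comp .fst
  have r1 : Primrec fun q : Stage × Requirement => q.2.1 := Primrec.fst.comp .snd
  have r2 : Primrec fun q : Stage × Requirement => q.2.2.1 :=
    Primrec.fst.comp (Primrec.snd.comp .snd)
  have r3 : Primrec fun q : Stage × Requirement => q.2.2.2.1 :=
    Primrec.fst.comp (Primrec.snd.comp (Primrec.snd.comp .snd))
  have r4 : Primrec fun q : Stage × Requirement => q.2.2.2.2 :=
    Primrec.snd.comp (Primrec.snd.comp (Primrec.snd.comp .snd))
  have hdy : Primrec fun q : Stage × Requirement => q.2.2.2.1 ++ [q.2.2.2.2] :=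
    Primrec.list_concat.comp r3 r4
  have hlt : DecIn (EmbedInfo K) fun p : (Stage × Requirement) × ℕ => p.2 < p.1.1.2.length :=
    .of_primrecPred (Primrec.nat_lt.comp .snd (Primrec.list_length.comp (s2.comp .fst)))
  have hj : DecIn (EmbedInfo K) fun p : (Stage × Requirement) × ℕ =>
      K.SimAt p.1.1.1 (select p.1.1.2 (p.1.2.1 ++ [p.2])) p.1.2.2.1
        (p.1.2.2.2.1 ++ [p.1.2.2.2.2]) :=
    .simAt K (.of_primrec (s1.comp .fst)) (.of_primrec (primrec_select.comp
      ((s2.comp .fst).pair (Primrec.list_concat.comp (r1.comp .fst) .snd))))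
      (.of_primrec (r2.comp .fst)) (.of_primrec (hdy.comp .fst))
  exact (DecIn.simAt K (.of_primrec s1) (.of_primrec s2) (.of_primrec s1) (.of_primrec s2)).and
    ((hlt.ball_list.comp (.of_primrec (Primrec.id.pair r1))).and
    ((DecIn.simAt K (.of_primrec s1) (.of_primrec (primrec_select.comp (s2.pair r1)))
      (.of_primrec r2) (.of_primrec r3)).and
    ((DecIn.simAt K (.of_primrec r2) (.of_primrec hdy) (.of_primrec r2) (.of_primrec hdy)).and
    (hj.exists_lt.comp (.of_primrec (Primrec.id.pair (Primrec.list_length.comp s2)))).not)))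

theorem CompAge.decIn_meets (K : CompAge L) :
    DecIn (EmbedInfo K) (fun q : (Stage × Requirement) × Stage => K.Meets q.1.1 q.1.2 q.2) := by
  have s1 : Primrec fun q : (Stage × Requirement) × Stage => q.1.1.1 :=
    Primrec.fst.comp (Primrec.fst.comp .fst)
  have s2 : Primrec fun q : (Stage × Requirement) × Stage => q.1.1.2 :=
    Primrec.snd.comp (Primrec.fst.comp .fst)
  have r : Primrec fun q : (Stage × Requirement) × Stage => q.1.2 := Primrec.snd.comp .fst
  have r2 : Primrec fun q : (Stage × Requirement) × Stage => q.1.2.2.1 :=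
    Primrec.fst.comp (Primrec.snd.comp r)
  have hdy : Primrec fun q : (Stage × Requirement) × Stage => q.1.2.2.2.1 ++ [q.1.2.2.2.2] :=
    Primrec.list_concat.comp (Primrec.fst.comp (Primrec.snd.comp (Primrec.snd.comp r)))
      (Primrec.snd.comp (Primrec.snd.comp (Primrec.snd.comp r)))
  have t1 : Primrec fun q : (Stage × Requirement) × Stage => q.2.1 := Primrec.fst.comp .snd
  have t2 : Primrec fun q : (Stage × Requirement) × Stage => q.2.2 := Primrec.snd.comp .snd
  have hl : Primrec fun q : (Stage × Requirement) × Stage => q.1.1.2.length :=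
    Primrec.list_length.comp s2
  have htake : Primrec fun q : (Stage × Requirement) × Stage => q.2.2.take q.1.1.2.length :=
    Primrec.list_take.comp hl t2
  exact (DecIn.of_primrecPred (Primrec.eq.comp (Primrec.list_length.comp t2)
      (Primrec.succ.comp hl))).and
    ((DecIn.simAt K (.of_primrec t1) (.of_primrec t2) (.of_primrec t1) (.of_primrec t2)).and
    ((DecIn.simAt K (.of_primrec s1) (.of_primrec s2) (.of_primrec t1) (.of_primrec htake)).and
    (DecIn.simAt K (.of_primrec t1) (.of_primrec (primrec_select.comp (t2.pair
      (Primrec.list_concat.comp (Primrec.fst.comp r) hl)))) (.of_primrec r2) (.of_primrec hdy))))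

theorem CompAge.exists_step {K : CompAge L} (hHP : HP K.cls) (hAP : AP K.cls) :
    ∃ step : Stage × Requirement → Stage, CompIn (EmbedInfo K) step ∧
      (∀ s r, K.Needs s r → K.Meets s r (step (s, r))) ∧
      ∀ s r, ¬ K.Needs s r → step (s, r) = s := by
  have hn : DecIn (EmbedInfo K) fun q : (Stage × Requirement) × Stage => K.Needs q.1.1 q.1.2 :=
    K.decIn_needs.comp (.of_primrec .fst)
  have he : DecIn (EmbedInfo K) fun q : (Stage × Requirement) × Stage => q.2 = q.1.1 :=
    .of_primrecPred (Primrec.eq.comp .snd (Primrec.fst.comp .fst))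
  obtain ⟨g, hg, h⟩ := ((hn.and K.decIn_meets).enumIn.or (hn.not.and he).enumIn).exists_compIn
    fun ⟨⟨k, b⟩, I, k₁, d, y⟩ => by
      by_cases hN : K.Needs (k, b) (I, k₁, d, y)
      · obtain ⟨k', b', h1, h2, h3, h4⟩ := K.exists_extension hHP hAP hN.1.1 hN.2.1 hN.2.2.2.1.1
          hN.2.2.1.2.2
        exact ⟨(k', b'), .inl ⟨hN, h1, CompAge.simAt_self.2 h2, h3, h4⟩⟩
      · exact ⟨(k, b), .inr ⟨hN, rfl⟩⟩
  exact ⟨g, hg, fun s r hN => ((h (s, r)).resolve_right fun h => h.1 hN).2,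
    fun s r hN => ((h (s, r)).resolve_left fun h => hN h.1).2⟩

theorem CompAge.clSim_nil {K : CompAge L} (hJEP : JEP K.cls) (k k' : ℕ) :
    ClSim (K.str k) [] (K.str k') [] := by
  obtain ⟨D, _, ⟨f, hf⟩, ⟨g, hg⟩⟩ := hJEP _ (K.mem_cls k) _ (K.mem_cls k')
  have h0 : ∀ A : Str L, TupleIn A [] := fun A x hx => by simp at hx
  exact (ClSim.of_emb hf (h0 _)).trans ((ClSim.of_emb hg (h0 _)).symm (h0 _))

/-- A step meeting a requirement preserves distinctness of the entries. -/
theorem CompAge.Meets.inj {K : CompAge L} {s s' : Stage} {r : Requirement} (hN : K.Needs s r)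
    (hM : K.Meets s r s')
    (hs : ∀ i j, i < s.2.length → j < s.2.length → s.2.getD i 0 = s.2.getD j 0 → i = j) :
    ∀ i j, i < s'.2.length → j < s'.2.length → s'.2.getD i 0 = s'.2.getD j 0 → i = j := by
  obtain ⟨hl, ht, ⟨hb, hb', hc⟩, hm⟩ := hM
  have key : ∀ j < s.2.length, s'.2.getD s.2.length 0 ≠ s'.2.getD j 0 := by
    intro j hj e
    have hI : ∀ i ∈ r.1 ++ [j], i < s.2.length := fun i hi => by
      rcases List.mem_append.1 hi with hi | hi
      · exact hN.2.1 i hi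
      · rwa [List.mem_singleton.1 hi]
    have h1 := hc.map_getD hb hI
    have e1 : select (s'.2.take s.2.length) (r.1 ++ [j]) =
        select s'.2 (r.1 ++ [s.2.length]) := by
      rw [select_congr fun i hi => getD_take (hI i hi), select_append, select_append]
      simp only [select, List.map_cons, List.map_nil, e]
    change ClSim _ (select _ _) _ (select _ _) at h1
    rw [e1] at h1
    refine hN.2.2.2.2 ⟨j, hj, fun x hx => ?_, hm.2.1, h1.trans hm.2.2⟩
    obtain ⟨i, hi, rfl⟩ := List.mem_map.1 hx
    refine hb _ ?_
    rw [List.getD_eq_getElem _ _ (hI i hi)]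
    exact List.getElem_mem _
  intro i j hi hj e
  rw [hl, Nat.lt_succ_iff_lt_or_eq] at hi hj
  rcases hi with hi | rfl <;> rcases hj with hj | rfl
  · refine hs i j hi hj ((hc.getD_inj hb hi hj).2 ?_)
    rwa [getD_take hi, getD_take hj]
  · exact absurd e.symm (key i hi)
  · exact absurd e (key j hj)
  · rfl

theorem CompAge.exists_genericChain {K : CompAge L} (hHP : HP K.cls) (hJEP : JEP K.cls)
    (hAP : AP K.cls) :
    ∃ S : GenericChain K, CompIn (EmbedInfo K) S.idx ∧ CompIn (EmbedInfo K) S.tup := by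
  obtain ⟨step, hc, hmeet, hstay⟩ := K.exists_step hHP hAP
  let req : ℕ → Requirement := fun n => (Encodable.decode n.unpair.1).getD ([], 0, [], 0)
  have hreq : Primrec req := Primrec.option_getD.comp
    (Primrec.decode.comp (Primrec.fst.comp Primrec.unpair)) (.const _)
  let st : ℕ → Stage := fun n => n.rec (0, []) fun n s => step (s, req n)
  have hst : CompIn (EmbedInfo K) st := by
    have h1 : CompIn (EmbedInfo K) fun q : Unit × ℕ × Stage => step (q.2.2, req q.2.1) :=
      hc.comp (.of_primrec ((Primrec.snd.comp .snd).pair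
        (hreq.comp (Primrec.fst.comp .snd))))
    exact (CompIn.nat_rec (.of_primrec (Primrec.const ((0, []) : Stage))) h1).comp
      (.of_primrec ((Primrec.const ()).pair Primrec.id))
  have hsucc : ∀ n, st (n + 1) = step (st n, req n) := fun n => rfl
  have hcases : ∀ n, (K.Needs (st n) (req n) ∧ K.Meets (st n) (req n) (st (n + 1))) ∨
      st (n + 1) = st n := fun n => by
    rw [hsucc]
    by_cases h : K.Needs (st n) (req n)
    · exact .inl ⟨h, hmeet _ _ h⟩
    · exact .inr (hstay _ _ h)
  have hmem : ∀ n, TupleIn (K.str (st n).1) (st n).2 := by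
    intro n
    induction n with
    | zero => exact fun x hx => absurd hx (by simp [st])
    | succ n ih =>
      rcases hcases n with ⟨_, h⟩ | h
      · exact h.2.1.1
      · rwa [h]
  refine ⟨{ idx := fun n => (st n).1, tup := fun n => (st n).2, tup_mem := hmem, mono := ?_,
            coh := ?_, inj := ?_, often := ?_, start := fun k => K.clSim_nil hJEP _ k },
    (CompIn.of_primrec .fst).comp hst, (CompIn.of_primrec .snd).comp hst⟩
  · intro n
    rcases hcases n with ⟨_, h⟩ | h
    · exact h.1 ▸ Nat.le_succ _
    · rw [h]
  · intro n
    rcases hcases n with ⟨_, h⟩ | h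
    · exact h.2.2.1.2.2
    · rw [h, List.take_length]
      exact .refl (hmem n)
  · intro n
    induction n with
    | zero => exact fun i j hi => absurd hi (by simp [st])
    | succ n ih =>
      rcases hcases n with ⟨hN, h⟩ | h
      · exact CompAge.Meets.inj hN h ih
      · rwa [h]
  · intro n I k d y
    refine ⟨Nat.pair (Encodable.encode ((I, k, d, y) : Requirement)) n, Nat.right_le_pair _ _,
      fun hI hd h => ?_⟩
    set m := Nat.pair (Encodable.encode ((I, k, d, y) : Requirement)) n with hm
    have hr : req m = (I, k, d, y) := by simp [req, hm]
    have hsel : TupleIn (K.str (st m).1) (select (st m).2 I) := fun x hx => by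
      obtain ⟨i, hi, rfl⟩ := List.mem_map.1 hx
      refine hmem m _ ?_
      rw [List.getD_eq_getElem _ _ (hI i hi)]
      exact List.getElem_mem _
    by_cases hex : ∃ j < (st m).2.length,
        K.SimAt (st m).1 (select (st m).2 (I ++ [j])) k (d ++ [y])
    · obtain ⟨j, hj, hj'⟩ := hex
      exact ⟨m, le_rfl, j, hj, hj'.2.2⟩
    · have hN : K.Needs (st m) (req m) := by
        rw [hr]
        exact ⟨CompAge.simAt_self.2 (hmem m), hI,
          ⟨hsel, fun x hx => hd x (List.mem_append_left _ hx), h⟩, CompAge.simAt_self.2 hd, hex⟩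
      have hM := hmeet _ _ hN
      rw [← hsucc] at hM
      refine ⟨m + 1, Nat.le_succ m, (st m).2.length, hM.1 ▸ Nat.lt_succ_self _, ?_⟩
      have := hM.2.2.2.2.2
      rwa [hr] at this

/-! ### Computability of the limit -/

section

variable {α β : Type*} [Primcodable α] [Primcodable β] {O : Set ℕ}

/-- The set of codes of a decidable predicate is decidable. -/
theorem DecIn.setRecIn_encode [Inhabited α] {p : α → Prop} (hp : DecIn O p) {A : Set ℕ}
    (hA : ∀ n, n ∈ A ↔ ∃ a, p a ∧ n = Encodable.encode a) : SetRecIn O A := by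
  have hd : Primrec fun n : ℕ => (Encodable.decode (α := α) n).getD default :=
    Primrec.option_getD_default.comp Primrec.decode
  refine (((hp.comp (.of_primrec hd)).and (.of_primrecPred (Primrec.eq.comp .id
    (Primrec.encode.comp hd)))).of_iff fun n => ?_).setRecIn
  rw [hA]
  constructor
  · rintro ⟨a, ha, rfl⟩
    simpa using ha
  · exact fun ⟨h, e⟩ => ⟨_, h, e⟩

/-- The graph of a partial function with decidable domain is decidable if it is enumerable. -/
theorem EnumIn.decIn_graph [Inhabited β] {p : α × β → Prop} {q : α → Prop} (hp : EnumIn O p)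
    (hq : DecIn O q) (h : ∀ a, (∃ b, p (a, b)) ↔ q a)
    (huniq : ∀ a b b', p (a, b) → p (a, b') → b = b') : DecIn O p := by
  have h1 : EnumIn O fun r : α × β => ∃ b, p (r.1, b) ∧ b ≠ r.2 := by
    have h2 : EnumIn O fun r : (α × β) × β => p (r.1.1, r.2) :=
      hp.comp (.of_primrec ((Primrec.fst.comp .fst).pair .snd))
    have h3 : DecIn O fun r : (α × β) × β => r.2 ≠ r.1.2 :=
      (DecIn.of_primrecPred (Primrec.eq.comp .snd (Primrec.snd.comp .fst))).not
    exact (h2.and h3.enumIn).ex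
  refine hp.decIn (((hq.not.comp (.of_primrec .fst)).enumIn.or h1).of_iff fun ⟨a, b⟩ => ?_)
  constructor
  · intro hn
    by_cases ha : q a
    · obtain ⟨b', hb'⟩ := (h a).2 ha
      exact .inr ⟨b', hb', fun e : b' = b => hn (e ▸ hb')⟩
    · exact .inl ha
  · rintro (hn | ⟨b', hb', hne⟩) hb
    · exact hn ((h a).1 ⟨b, hb⟩)
    · exact hne (huniq a _ _ hb' hb)

theorem TotalComputableIn.decIn_arity {ar : ℕ → Option ℕ}
    (h : TotalComputableIn ∅ fun r => Encodable.encode (ar r)) :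
    DecIn O fun q : ℕ × List ℕ => ar q.1 = some q.2.length := by
  have h1 : CompIn O fun q : ℕ × List ℕ => Encodable.encode (ar q.1) :=
    .of_computable (h.computable.comp .fst)
  have h2 : CompIn O fun q : ℕ × List ℕ => Encodable.encode (some q.2.length) :=
    .of_primrec (Primrec.encode.comp (Primrec.option_some.comp (Primrec.list_length.comp .snd)))
  have h3 : DecIn O fun q : ℕ × ℕ => q.1 = q.2 := .of_primrecPred (Primrec.eq.comp .fst .snd)
  exact (h3.comp (h1.pair h2)).of_iff fun q => Encodable.encode_inj.symm

end

namespace CompAge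

variable {K : CompAge L}

theorem encode_mem_diag_two {i r : ℕ} {as : List ℕ} :
    Encodable.encode (2, i, r, as) ∈ K.diag ↔ TupleIn (K.str i) as ∧ (K.str i).rel r as := by
  simp [diag]

theorem encode_mem_diag_three {i r : ℕ} {as : List ℕ} :
    Encodable.encode (3, i, r, as) ∈ K.diag ↔
      TupleIn (K.str i) as ∧ L.relArity r = some as.length ∧ ¬ (K.str i).rel r as := by
  simp [diag]

theorem encode_mem_diag_four {i f : ℕ} {as : List ℕ} {b : ℕ} :
    Encodable.encode (4, i, f, as, b) ∈ K.diag ↔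
      TupleIn (K.str i) as ∧ L.funArity f = some as.length ∧ (K.str i).fn f as = b := by
  simp [diag, eq_comm]

theorem decIn_tupleIn (K : CompAge L) :
    DecIn (EmbedInfo K) fun q : ℕ × List ℕ => TupleIn (K.str q.1) q.2 :=
  (DecIn.simAt K (.of_primrec .fst) (.of_primrec .snd) (.of_primrec .fst)
    (.of_primrec .snd)).of_iff fun _ => simAt_self.symm

theorem decIn_rel (hL : L.ComputableRep) (hK : CEIn ∅ K.diag) :
    DecIn (EmbedInfo K) fun q : ℕ × ℕ × List ℕ => (K.str q.1).rel q.2.1 q.2.2 := by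
  have henc : ∀ c : ℕ, EnumIn (EmbedInfo K)
      fun q : ℕ × ℕ × List ℕ => Encodable.encode (c, q) ∈ K.diag := fun c =>
    (EnumIn.of_cEIn_empty hK).comp
      (.of_primrec (Primrec.encode.comp ((Primrec.const c).pair .id)))
  have ht : DecIn (EmbedInfo K) fun q : ℕ × ℕ × List ℕ => TupleIn (K.str q.1) q.2.2 :=
    K.decIn_tupleIn.comp (.of_primrec (Primrec.fst.pair (Primrec.snd.comp .snd)))
  have ha : DecIn (EmbedInfo K) fun q : ℕ × ℕ × List ℕ => L.relArity q.2.1 = some q.2.2.length :=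
    hL.1.decIn_arity.comp (.of_primrec .snd)
  refine ((henc 2).of_iff fun ⟨i, r, as⟩ => ?_).decIn
    ((ht.not.enumIn.or (ha.not.enumIn.or (henc 3))).of_iff fun ⟨i, r, as⟩ => ?_)
  · rw [encode_mem_diag_two]
    exact ⟨fun h => ⟨((K.str i).rel_valid r as h).2, h⟩, fun h => h.2⟩
  · rw [encode_mem_diag_three]
    have := (K.str i).rel_valid r as
    simp only [TupleIn]
    tauto

theorem enumIn_fn (hK : CEIn ∅ K.diag) :
    EnumIn (EmbedInfo K) fun q : ℕ × ℕ × List ℕ × ℕ => TupleIn (K.str q.1) q.2.2.1 ∧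
      L.funArity q.2.1 = some q.2.2.1.length ∧ (K.str q.1).fn q.2.1 q.2.2.1 = q.2.2.2 :=
  ((EnumIn.of_cEIn_empty hK).comp (.of_primrec (Primrec.encode.comp
    ((Primrec.const 4).pair .id)))).of_iff fun _ => encode_mem_diag_four.symm

end CompAge

namespace GenericChain

variable {K : CompAge L} {S : GenericChain K}

/-- The stages of the chain are computable in the embedding information. -/
def Comp (S : GenericChain K) : Prop :=
  CompIn (EmbedInfo K) S.idx ∧ CompIn (EmbedInfo K) S.tup

theorem Comp.map_val (hS : S.Comp) :
    CompIn (EmbedInfo K) fun q : ℕ × List ℕ => q.2.map (S.val q.1) :=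
  (CompIn.of_primrec primrec_select).comp
    ((hS.2.comp (.of_primrec .fst)).pair (.of_primrec .snd))

theorem Comp.val (hS : S.Comp) : CompIn (EmbedInfo K) fun q : ℕ × ℕ => S.val q.1 q.2 :=
  (CompIn.of_primrec (f := fun q : List ℕ × ℕ => q.1.getD q.2 0) (Primrec.list_getD 0)).comp
    ((hS.2.comp (.of_primrec .fst)).pair (.of_primrec .snd))

theorem Comp.decIn_lt (hS : S.Comp) :
    DecIn (EmbedInfo K) fun q : ℕ × ℕ => q.2 < (S.tup q.1).length := by
  have h : DecIn (EmbedInfo K) fun q : ℕ × List ℕ => q.1 < q.2.length :=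
    .of_primrecPred (Primrec.nat_lt.comp .fst (Primrec.list_length.comp .snd))
  exact h.comp ((CompIn.of_primrec .snd).pair (hS.2.comp (.of_primrec .fst)))

theorem Comp.decIn_in (hS : S.Comp) :
    DecIn (EmbedInfo K) fun q : ℕ × List ℕ => S.In q.1 q.2 := hS.decIn_lt.ball_list

theorem decIn_dom (S : GenericChain K) (O : Set ℕ) : DecIn O fun j => j ∈ S.limit.dom := by
  by_cases h : ∀ j, j ∈ S.limit.dom
  · exact DecIn.of_computable (Computable.const true) fun j => by simp [h j]
  · push Not at h
    obtain ⟨N, hN, hmin⟩ := Nat.findX h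
    refine (DecIn.of_primrecPred (p := fun j => j < N)
      (Primrec.nat_lt.comp .id (.const N))).of_iff fun j => ?_
    refine ⟨fun ⟨n, hn⟩ => ?_, fun hj => not_not.1 (hmin j hj)⟩
    by_contra hj
    exact hN ⟨n, (not_lt.1 hj).trans_lt hn⟩

theorem decIn_tupleIn_limit (S : GenericChain K) (O : Set ℕ) :
    DecIn O fun as : List ℕ => TupleIn S.limit as := by
  have h : DecIn O fun q : Unit × ℕ => q.2 ∈ S.limit.dom := (S.decIn_dom O).comp (.of_primrec .snd)
  exact h.ball_list.comp (.of_primrec ((Primrec.const ()).pair .id))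

theorem Comp.decIn_rel (hS : S.Comp) (hL : L.ComputableRep) (hK : CEIn ∅ K.diag) :
    DecIn (EmbedInfo K) fun q : ℕ × List ℕ => S.limit.rel q.1 q.2 := by
  have hin : DecIn (EmbedInfo K) fun q : (ℕ × List ℕ) × ℕ => S.In q.2 q.1.2 :=
    hS.decIn_in.comp (.of_primrec (Primrec.snd.pair (Primrec.snd.comp .fst)))
  have hrel : DecIn (EmbedInfo K) fun q : (ℕ × List ℕ) × ℕ =>
      (S.str q.2).rel q.1.1 (q.1.2.map (S.val q.2)) :=
    (CompAge.decIn_rel hL hK).comp ((hS.1.comp (.of_primrec .snd)).pair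
      ((CompIn.of_primrec (Primrec.fst.comp .fst)).pair
        (hS.map_val.comp (.of_primrec (Primrec.snd.pair (Primrec.snd.comp .fst))))))
  have ht := (S.decIn_tupleIn_limit (EmbedInfo K)).comp
    (CompIn.of_primrec (Primrec.snd : Primrec (Prod.snd : ℕ × List ℕ → List ℕ)))
  refine (hin.and hrel).enumIn.ex.decIn
    ((ht.not.enumIn.or (hin.and hrel.not).enumIn.ex).of_iff fun ⟨r, as⟩ => ?_)
  change ¬ S.limit.rel r as ↔ _
  constructor
  · intro hn
    by_cases has : TupleIn S.limit as
    · obtain ⟨n, hn'⟩ := S.eventually_in has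
      exact .inr ⟨n, hn' n le_rfl, fun h => hn ⟨n, hn' n le_rfl, h⟩⟩
    · exact .inl has
  · rintro (h | ⟨n, hn, h⟩) hr
    · exact h (S.limit.rel_valid r as hr).2
    · exact h ((S.rel_iff hn r).1 hr)

theorem Comp.decIn_fn (hS : S.Comp) (hL : L.ComputableRep) (hK : CEIn ∅ K.diag) :
    DecIn (EmbedInfo K) fun q : (ℕ × List ℕ) × ℕ => L.funArity q.1.1 = some q.1.2.length ∧
      TupleIn S.limit q.1.2 ∧ S.limit.fn q.1.1 q.1.2 = q.2 := by
  have hdom : DecIn (EmbedInfo K) fun q : ℕ × List ℕ => L.funArity q.1 = some q.2.length ∧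
      TupleIn S.limit q.2 :=
    hL.2.decIn_arity.and ((S.decIn_tupleIn_limit _).comp (.of_primrec .snd))
  have a1 : Primrec fun q : ((ℕ × List ℕ) × ℕ) × ℕ => q.1.1.1 :=
    Primrec.fst.comp (Primrec.fst.comp .fst)
  have a2 : Primrec fun q : ((ℕ × List ℕ) × ℕ) × ℕ => q.1.1.2 :=
    Primrec.snd.comp (Primrec.fst.comp .fst)
  have a3 : Primrec fun q : ((ℕ × List ℕ) × ℕ) × ℕ => q.1.2 := Primrec.snd.comp .fst
  have hin : DecIn (EmbedInfo K) fun q : ((ℕ × List ℕ) × ℕ) × ℕ => S.In q.2 q.1.1.2 :=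
    hS.decIn_in.comp (.of_primrec (Primrec.snd.pair a2))
  have hlt : DecIn (EmbedInfo K) fun q : ((ℕ × List ℕ) × ℕ) × ℕ =>
      q.1.2 < (S.tup q.2).length := hS.decIn_lt.comp (.of_primrec (Primrec.snd.pair a3))
  have hfn := (CompAge.enumIn_fn hK).comp ((hS.1.comp (.of_primrec (Primrec.snd :
    Primrec (Prod.snd : ((ℕ × List ℕ) × ℕ) × ℕ → ℕ)))).pair ((CompIn.of_primrec a1).pair
      ((hS.map_val.comp (.of_primrec (Primrec.snd.pair a2))).pair
        (hS.val.comp (.of_primrec (Primrec.snd.pair a3))))))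
  refine ((hin.enumIn.and (hlt.enumIn.and hfn)).ex.of_iff fun ⟨⟨f, as⟩, b⟩ => ?_).decIn_graph hdom
    (fun ⟨f, as⟩ => ⟨fun ⟨b, h⟩ => ⟨h.1, h.2.1⟩, fun h => ⟨S.limit.fn f as, h.1, h.2, rfl⟩⟩)
    fun _ _ _ h h' => h.2.2.symm.trans h'.2.2
  dsimp only
  constructor
  · rintro ⟨ha, has, rfl⟩
    obtain ⟨n, hn⟩ := S.eventually_in has
    obtain ⟨n', hn'⟩ := S.fn_mem_limit ha has
    have h1 := hn _ (le_max_left n n')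
    have h2 := hn'.trans_le (S.len_mono (le_max_right n n'))
    exact ⟨max n n', h1, h2, S.map_val_mem h1, by simpa using ha, (S.fn_iff h1 ha h2).1 rfl⟩
  · rintro ⟨n, h1, h2, -, ha, he⟩
    have ha : L.funArity f = some as.length := by simpa using ha
    exact ⟨ha, h1.tupleIn, (S.fn_iff h1 ha h2).2 he⟩

theorem Comp.strComputableIn_limit (hS : S.Comp) (hL : L.ComputableRep) (hK : CEIn ∅ K.diag) :
    StrComputableIn (EmbedInfo K) S.limit := by
  refine ⟨(S.decIn_dom _).setRecIn, (hS.decIn_rel hL hK).setRecIn_encode fun n => ?_,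
    ((hS.decIn_fn hL hK).comp (.of_primrec (f := fun q : ℕ × List ℕ × ℕ => ((q.1, q.2.1), q.2.2))
      ((Primrec.fst.pair (Primrec.fst.comp .snd)).pair (Primrec.snd.comp .snd)))).setRecIn_encode
      fun n => ?_⟩
  · constructor
    · rintro ⟨r, as, _, h, rfl⟩
      exact ⟨(r, as), h, rfl⟩
    · rintro ⟨⟨r, as⟩, h, rfl⟩
      exact ⟨r, as, (S.limit.rel_valid r as h).2, h, rfl⟩
  · constructor
    · rintro ⟨f, as, b, h, h', h'', rfl⟩
      exact ⟨(f, as, b), ⟨h, h', h''⟩, rfl⟩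
    · rintro ⟨⟨f, as, b⟩, ⟨h, h', h''⟩, rfl⟩
      exact ⟨f, as, b, h, h', h'', rfl⟩

end GenericChain

/-! ### Effective back-and-forth -/

/-- The finite list `l` of pairs is a partial isomorphism of `M`. -/
def Matched (M : Str L) (l : List (ℕ × ℕ)) : Prop :=
  TupleIn M (l.map Prod.fst) ∧ TupleIn M (l.map Prod.snd) ∧
    ClSim M (l.map Prod.fst) M (l.map Prod.snd)

namespace Matched

variable {M : Str L} {l : List (ℕ × ℕ)}

theorem swap (h : Matched M l) : Matched M (l.map Prod.swap) := by
  have h1 : (l.map Prod.swap).map Prod.fst = l.map Prod.snd := by simp [Function.comp_def]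
  have h2 : (l.map Prod.swap).map Prod.snd = l.map Prod.fst := by simp [Function.comp_def]
  rw [Matched, h1, h2]
  exact ⟨h.2.1, h.1, h.2.2.symm h.1⟩

theorem exists_emb (h : Matched M l) : ∃ k : ℕ → ℕ, (∀ p ∈ l, p.2 = k p.1) ∧
    (∀ p ∈ l, InClosure M (l.map Prod.fst) p.1) ∧ IsEmbMap (M.sub (l.map Prod.fst)) M k := by
  obtain ⟨k, e, hk⟩ := h.2.2.exists_emb
  rw [List.map_map] at e
  exact ⟨k, fun p hp => (List.map_inj_left.1 e p hp).symm,
    fun p hp => .self h.1 _ (List.mem_map_of_mem hp), hk⟩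

end Matched

/-- A relation that is, on every finite tuple, contained in a partial isomorphism and that is
total and surjective is the graph of an automorphism. -/
theorem isAutoOf_of_matched {M : Str L} {l : ℕ → List (ℕ × ℕ)} (hl : ∀ n, Matched M (l n))
    (hmono : ∀ n m, n ≤ m → l n ⊆ l m) {g : ℕ → ℕ}
    (hg : ∀ x ∈ M.dom, ∃ n, (x, g x) ∈ l n)
    (hsurj : ∀ y ∈ M.dom, ∃ x n, (x, y) ∈ l n) :
    IsAutoOf M g ∧ ∀ n, ∀ p ∈ l n, g p.1 = p.2 := by
  have hfin : ∀ as : List ℕ, TupleIn M as → ∃ n, ∀ x ∈ as, (x, g x) ∈ l n := by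
    intro as has
    choose! k hk using hg
    exact ⟨(as.map k).sum, fun x hx => hmono _ _
      (List.single_le_sum (by simp) _ (List.mem_map_of_mem hx)) (hk x (has x hx))⟩
  have key : ∀ as : List ℕ, TupleIn M as → ∃ cs k, IsEmbMap (M.sub cs) M k ∧
      (∀ x ∈ as, InClosure M cs x) ∧ ∀ x ∈ as, g x = k x := by
    intro as has
    obtain ⟨n, hn⟩ := hfin as has
    obtain ⟨k, h1, h2, h3⟩ := (hl n).exists_emb
    exact ⟨_, k, h3, fun x hx => h2 _ (hn x hx), fun x hx => h1 _ (hn x hx)⟩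
  have hfun : ∀ n, ∀ p ∈ l n, g p.1 = p.2 := by
    intro n p hp
    obtain ⟨m, hm⟩ := hg p.1 ((hl n).1 _ (List.mem_map_of_mem hp))
    obtain ⟨k, h1, -, -⟩ := (hl (max n m)).exists_emb
    exact (h1 _ (hmono _ _ (le_max_right n m) hm)).trans
      (h1 _ (hmono _ _ (le_max_left n m) hp)).symm
  refine ⟨⟨⟨fun x hx => ?_, fun x hx y hy e => ?_, fun r as has => ?_, fun f as hf has => ?_⟩,
    fun y hy => ?_⟩, hfun⟩
  · obtain ⟨n, hn⟩ := hg x hx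
    exact (hl n).2.1 _ (List.mem_map_of_mem hn)
  · obtain ⟨cs, k, hk, hc, he⟩ := key [x, y] (by simp [TupleIn, hx, hy])
    rw [he x (by simp), he y (by simp)] at e
    exact hk.2.1 x (hc x (by simp)) y (hc y (by simp)) e
  · obtain ⟨cs, k, hk, hc, he⟩ := key as has
    rw [map_congr_mem he, ← hk.2.2.1 r as hc]
    exact ⟨fun h => ⟨h, hc⟩, fun h => h.1⟩
  · obtain ⟨cs, k, hk, hc, he⟩ := key (M.fn f as :: as) fun x hx => by
      rcases List.mem_cons.1 hx with rfl | hx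
      · exact M.fn_mem f as hf has
      · exact has x hx
    rw [he _ (by simp), map_congr_mem fun x hx => he x (List.mem_cons_of_mem _ hx)]
    exact hk.2.2.2 f as hf fun x hx => hc x (List.mem_cons_of_mem _ hx)
  · obtain ⟨x, n, hn⟩ := hsurj y hy
    exact ⟨x, (hl n).1 _ (List.mem_map_of_mem hn), hfun n _ hn⟩

section BackAndForth

variable {O : Set ℕ} {M : Str L}

theorem exists_forth (hdom : DecIn O fun x => x ∈ M.dom) (hm : DecIn O (Matched M))
    (hext : ∀ l c, Matched M l → c ∈ M.dom → ∃ d, Matched M (l ++ [(c, d)])) :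
    ∃ forth : List (ℕ × ℕ) × ℕ → List (ℕ × ℕ), CompIn O forth ∧
      (∀ l c, l ⊆ forth (l, c)) ∧ (∀ l c, Matched M l → Matched M (forth (l, c))) ∧
      ∀ l c, Matched M l → c ∈ M.dom → ∃ d, (c, d) ∈ forth (l, c) := by
  have hgood : DecIn O fun q : (List (ℕ × ℕ) × ℕ) × List (ℕ × ℕ) =>
      Matched M q.1.1 ∧ q.1.2 ∈ M.dom :=
    (hm.comp (.of_primrec (Primrec.fst.comp .fst))).and
      (hdom.comp (.of_primrec (Primrec.snd.comp .fst)))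
  have hstay : DecIn O fun q : (List (ℕ × ℕ) × ℕ) × List (ℕ × ℕ) => q.2 = q.1.1 :=
    .of_primrecPred (Primrec.eq.comp .snd (Primrec.fst.comp .fst))
  have hadd : DecIn O fun r : ((List (ℕ × ℕ) × ℕ) × List (ℕ × ℕ)) × ℕ =>
      r.1.2 = r.1.1.1 ++ [(r.1.1.2, r.2)] :=
    .of_primrecPred (Primrec.eq.comp (Primrec.snd.comp .fst)
      (Primrec.list_concat.comp (Primrec.fst.comp (Primrec.fst.comp .fst))
        ((Primrec.snd.comp (Primrec.fst.comp .fst)).pair .snd)))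
  have hnew : DecIn O fun q : (List (ℕ × ℕ) × ℕ) × List (ℕ × ℕ) => Matched M q.2 :=
    hm.comp (.of_primrec .snd)
  obtain ⟨g, hg, h⟩ := ((hgood.enumIn.and (hnew.enumIn.and hadd.enumIn.ex)).or
    (hgood.not.and hstay).enumIn).exists_compIn fun ⟨l, c⟩ => by
      by_cases hlc : Matched M l ∧ c ∈ M.dom
      · obtain ⟨d, hd⟩ := hext l c hlc.1 hlc.2
        exact ⟨_, .inl ⟨hlc, hd, d, rfl⟩⟩
      · exact ⟨l, .inr ⟨hlc, rfl⟩⟩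
  have h : ∀ l c, ((Matched M l ∧ c ∈ M.dom) ∧ Matched M (g (l, c)) ∧
      ∃ d, g (l, c) = l ++ [(c, d)]) ∨ ¬(Matched M l ∧ c ∈ M.dom) ∧ g (l, c) = l :=
    fun l c => h (l, c)
  refine ⟨g, hg, fun l c => ?_, fun l c hl => ?_, fun l c hl hc => ?_⟩
  · rcases h l c with ⟨_, _, d, e⟩ | ⟨_, e⟩
    · exact fun p hp => by
        rw [e]
        exact List.mem_append_left _ hp
    · exact fun p hp => by rwa [e]
  · rcases h l c with ⟨_, h, _⟩ | ⟨_, e⟩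
    · exact h
    · rwa [e]
  · rcases h l c with ⟨_, _, d, e⟩ | ⟨h, _⟩
    · exact ⟨d, by rw [e]; simp⟩
    · exact absurd ⟨hl, hc⟩ h

theorem exists_back_and_forth (hdom : DecIn O fun x => x ∈ M.dom) (hm : DecIn O (Matched M))
    (hext : ∀ l c, Matched M l → c ∈ M.dom → ∃ d, Matched M (l ++ [(c, d)])) :
    ∃ s : List (ℕ × ℕ) × ℕ → List (ℕ × ℕ), CompIn O s ∧ (∀ l, s (l, 0) = l) ∧
      (∀ l n m, n ≤ m → s (l, n) ⊆ s (l, m)) ∧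
      (∀ l, Matched M l → ∀ n, Matched M (s (l, n))) ∧
      ∀ l, Matched M l → ∀ x ∈ M.dom, (∃ y n, (x, y) ∈ s (l, n)) ∧ ∃ y n, (y, x) ∈ s (l, n) := by
  obtain ⟨forth, hc, hsub, hmat, hmem⟩ := exists_forth hdom hm hext
  let swap : List (ℕ × ℕ) → List (ℕ × ℕ) := List.map Prod.swap
  have hswap : Primrec swap := Primrec.list_map .id ((Primrec.snd.pair .fst).comp .snd)
  let stp : List (ℕ × ℕ) × ℕ → List (ℕ × ℕ) := fun q => swap (forth (swap (forth q), q.2))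
  have hstp : CompIn O stp := (CompIn.of_primrec hswap).comp
    (hc.comp (((CompIn.of_primrec hswap).comp hc).pair (.of_primrec .snd)))
  have hss : ∀ l c, forth (l, c) ⊆ stp (l, c) := fun l c p hp => by
    have h1 : p.swap ∈ swap (forth (l, c)) := List.mem_map_of_mem hp
    have h2 := List.mem_map_of_mem (f := Prod.swap) (hsub _ c h1)
    rwa [Prod.swap_swap] at h2
  let s : List (ℕ × ℕ) × ℕ → List (ℕ × ℕ) := fun q => q.2.rec q.1 fun n l => stp (l, n)
  have hsucc : ∀ l n, s (l, n + 1) = stp (s (l, n), n) := fun l n => rfl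
  have hs : CompIn O s := CompIn.nat_rec (g := fun q : List (ℕ × ℕ) × ℕ × List (ℕ × ℕ) =>
    stp (q.2.2, q.2.1)) (.of_primrec .id) (hstp.comp (.of_primrec
      ((Primrec.snd.comp .snd).pair (Primrec.fst.comp .snd))))
  have hsm : ∀ l, Matched M l → ∀ n, Matched M (s (l, n)) := fun l hl n => by
    induction n with
    | zero => exact hl
    | succ n ih => exact (hmat _ _ (hmat _ _ ih).swap).swap
  refine ⟨s, hs, fun l => rfl, fun l n m hnm => ?_, hsm, fun l hl x hx => ⟨?_, ?_⟩⟩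
  · induction m, hnm using Nat.le_induction with
    | base => exact fun p hp => hp
    | succ m _ ih => exact fun p hp => hss _ _ (hsub _ _ (ih hp))
  · obtain ⟨d, hd⟩ := hmem _ x (hsm l hl x) hx
    exact ⟨d, x + 1, hss _ _ hd⟩
  · obtain ⟨d, hd⟩ := hmem _ x (hmat _ x (hsm l hl x)).swap hx
    exact ⟨d, x + 1, List.mem_map_of_mem (f := Prod.swap) hd⟩

theorem exists_compIn_zip : ∃ z : List ℕ × List ℕ → List (ℕ × ℕ), CompIn O z ∧
    ∀ as bs, as.length = bs.length →
      (z (as, bs)).map Prod.fst = as ∧ (z (as, bs)).map Prod.snd = bs := by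
  have hz : Primrec fun q : List ℕ × List ℕ =>
      (List.range q.1.length).map fun i => (q.1.getD i 0, q.2.getD i 0) :=
    Primrec.list_map (Primrec.list_range.comp (Primrec.list_length.comp .fst))
      (((Primrec.list_getD 0).comp (Primrec.fst.comp .fst) .snd).pair
        ((Primrec.list_getD 0).comp (Primrec.snd.comp .fst) .snd))
  have hr : ∀ l : List ℕ, ((List.range l.length).map fun i => l.getD i 0) = l := fun l =>
    List.ext_getElem (by simp) fun i h1 h2 => by simp [h2]
  refine ⟨_, .of_primrec hz, fun as bs h => ?_⟩
  rw [List.map_map, List.map_map]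
  exact ⟨hr as, by rw [h]; exact hr bs⟩

/-- A structure with decidable finite partial isomorphisms and the extension property is
computably ultrahomogeneous. -/
theorem compUltrahom_of_matched (hdom : DecIn O fun x => x ∈ M.dom) (hm : DecIn O (Matched M))
    (hext : ∀ l c, Matched M l → c ∈ M.dom → ∃ d, Matched M (l ++ [(c, d)])) :
    CompUltrahom O M := by
  obtain ⟨s, hs, hs0, hmono, hsm, hmem⟩ := exists_back_and_forth hdom hm hext
  obtain ⟨z, hz, hz'⟩ := exists_compIn_zip (O := O)
  have hgood : DecIn O fun q : (List (ℕ × ℕ) × ℕ) × ℕ => Matched M q.1.1 ∧ q.1.2 ∈ M.dom :=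
    (hm.comp (.of_primrec (Primrec.fst.comp .fst))).and
      (hdom.comp (.of_primrec (Primrec.snd.comp .fst)))
  have hin : DecIn O fun r : ((List (ℕ × ℕ) × ℕ) × ℕ) × ℕ =>
      (r.1.1.2, r.1.2) ∈ s (r.1.1.1, r.2) := by
    have h1 : DecIn O fun q : (ℕ × ℕ) × (ℕ × ℕ) => q.2 ≠ q.1 :=
      (DecIn.of_primrecPred (Primrec.eq.comp .snd .fst)).not
    refine (h1.ball_list.not.comp ((CompIn.of_primrec ((Primrec.snd.comp
      (Primrec.fst.comp .fst)).pair (Primrec.snd.comp .fst))).pair (hs.comp (.of_primrec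
      ((Primrec.fst.comp (Primrec.fst.comp .fst)).pair .snd))))).of_iff fun r => ?_
    simp
  have hid : DecIn O fun q : (List (ℕ × ℕ) × ℕ) × ℕ => q.2 = q.1.2 :=
    .of_primrecPred (Primrec.eq.comp .snd (Primrec.snd.comp .fst))
  obtain ⟨g, hg, h⟩ := ((hgood.enumIn.and hin.enumIn.ex).or
    (hgood.not.and hid).enumIn).exists_compIn fun ⟨l, x⟩ => by
      by_cases hlx : Matched M l ∧ x ∈ M.dom
      · obtain ⟨y, n, hy⟩ := (hmem l hlx.1 x hlx.2).1
        exact ⟨y, .inl ⟨hlx, n, hy⟩⟩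
      · exact ⟨x, .inr ⟨hlx, rfl⟩⟩
  obtain ⟨e, he⟩ := CompIn.exists_index (f := fun q : (List ℕ × List ℕ) × ℕ => g (z q.1, q.2))
    (hg.comp ((hz.comp (.of_primrec .fst)).pair (.of_primrec .snd)))
  refine ⟨e, fun as bs has hbs hlen => ?_⟩
  obtain ⟨i, hi, c, hc, hcg⟩ := he (as, bs)
  refine ⟨i, hi, c, hc, _, hcg, ?_⟩
  dsimp only
  obtain ⟨hz1, hz2⟩ := hz' as bs hlen
  generalize z (as, bs) = l at hz1 hz2
  by_cases hl : Matched M l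
  · obtain ⟨ha, hp⟩ := isAutoOf_of_matched (g := fun x => g (l, x)) (hsm l hl) (hmono l)
      (fun x hx => ((h (l, x)).resolve_right fun h => h.1 ⟨hl, hx⟩).2)
      fun y hy => (hmem l hl y hy).2
    refine ⟨⟨ha.1.1, ha.1.2.1, ha.2⟩, fun _ => ⟨ha, ?_⟩⟩
    rw [← hz1, ← hz2, List.map_map]
    refine map_congr_mem fun p hpl => hp 0 p ?_
    rwa [hs0]
  · have hgx : ∀ x, g (l, x) = x := fun x => ((h (l, x)).resolve_left fun h => hl h.1.1).2
    simp only [hgx]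
    refine ⟨⟨fun x hx => hx, fun x _ y _ e => e, fun y hy => ⟨y, hy, rfl⟩⟩, fun hc => ?_⟩
    exact absurd ⟨by rwa [hz1], by rwa [hz2], by rwa [hz1, hz2]⟩ hl

end BackAndForth

namespace GenericChain

variable {K : CompAge L} {S : GenericChain K}

theorem exists_matched (S : GenericChain K) {l : List (ℕ × ℕ)} {c : ℕ}
    (hl : Matched S.limit l) (hc : c ∈ S.limit.dom) : ∃ d, Matched S.limit (l ++ [(c, d)]) := by
  have happ : ∀ {as : List ℕ} {x : ℕ}, TupleIn S.limit as → x ∈ S.limit.dom →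
      TupleIn S.limit (as ++ [x]) := fun has hx y hy => by
    rcases List.mem_append.1 hy with hy | hy
    · exact has y hy
    · rwa [List.mem_singleton.1 hy]
  obtain ⟨d, hd, h⟩ := S.extend_limit hl.2.1 hl.1 hc (hl.2.2.symm hl.1)
  refine ⟨d, ?_⟩
  rw [Matched, List.map_append, List.map_append]
  exact ⟨happ hl.1 hc, happ hl.2.1 hd, h.symm (happ hl.2.1 hd)⟩

theorem Comp.decIn_matched (hS : S.Comp) : DecIn (EmbedInfo K) (Matched S.limit) := by
  have m1 : Primrec fun l : List (ℕ × ℕ) => l.map Prod.fst :=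
    Primrec.list_map .id (Primrec.fst.comp .snd)
  have m2 : Primrec fun l : List (ℕ × ℕ) => l.map Prod.snd :=
    Primrec.list_map .id (Primrec.snd.comp .snd)
  have t1 := (S.decIn_tupleIn_limit (EmbedInfo K)).comp (.of_primrec m1)
  have t2 := (S.decIn_tupleIn_limit (EmbedInfo K)).comp (.of_primrec m2)
  have p1 : Primrec fun q : List (ℕ × ℕ) × ℕ => (q.2, q.1.map Prod.fst) :=
    Primrec.snd.pair (m1.comp .fst)
  have p2 : Primrec fun q : List (ℕ × ℕ) × ℕ => (q.2, q.1.map Prod.snd) :=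
    Primrec.snd.pair (m2.comp .fst)
  have i1 := hS.decIn_in.comp (.of_primrec p1)
  have i2 := hS.decIn_in.comp (.of_primrec p2)
  have hidx : CompIn (EmbedInfo K) fun q : List (ℕ × ℕ) × ℕ => S.idx q.2 :=
    hS.1.comp (.of_primrec .snd)
  have hsim := DecIn.simAt K hidx (hS.map_val.comp (.of_primrec p1)) hidx
    (hS.map_val.comp (.of_primrec p2))
  refine ((i1.and (i2.and hsim)).enumIn.ex.of_iff fun l => ?_).decIn
    ((t1.not.enumIn.or (t2.not.enumIn.or (i1.and (i2.and hsim.not)).enumIn.ex)).of_iff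
      fun l => ?_)
  · dsimp only
    constructor
    · rintro ⟨h1, h2, h⟩
      obtain ⟨n, hn⟩ := S.eventually_in h1
      obtain ⟨m, hm⟩ := S.eventually_in h2
      have hn := hn _ (le_max_left n m)
      have hm := hm _ (le_max_right n m)
      exact ⟨max n m, hn, hm, S.map_val_mem hn, S.map_val_mem hm, (S.clSim_limit_iff hn hm).1 h⟩
    · rintro ⟨n, h1, h2, -, -, h⟩
      exact ⟨h1.tupleIn, h2.tupleIn, (S.clSim_limit_iff h1 h2).2 h⟩
  · dsimp only
    constructor
    · intro hnm
      by_cases h1 : TupleIn S.limit (l.map Prod.fst)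
      · by_cases h2 : TupleIn S.limit (l.map Prod.snd)
        · obtain ⟨n, hn⟩ := S.eventually_in h1
          obtain ⟨m, hm⟩ := S.eventually_in h2
          have hn := hn _ (le_max_left n m)
          have hm := hm _ (le_max_right n m)
          exact .inr (.inr ⟨max n m, hn, hm,
            fun h => hnm ⟨h1, h2, (S.clSim_limit_iff hn hm).2 h.2.2⟩⟩)
        · exact .inr (.inl h2)
      · exact .inl h1
    · rintro (h | h | ⟨n, h1, h2, h⟩) hl
      · exact h hl.1
      · exact h hl.2.1
      · exact h ⟨S.map_val_mem h1, S.map_val_mem h2, (S.clSim_limit_iff h1 h2).1 hl.2.2⟩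

end GenericChain

/-- If `𝕂` is a computable age with HP, JEP and AP, then `𝕂` has an
`EmbedInfo(𝕂)`-computable Fraïssé limit. -/
theorem fraisse_limit_embedinfo {L : Lang} (hL : L.ComputableRep)
    (K : CompAge L) (hK : AgeComputableIn ∅ K)
    (hHP : HP K.cls) (hJEP : JEP K.cls) (hAP : AP K.cls) :
    ∃ M : Str L, StrComputableIn (EmbedInfo K) M ∧
      CompUltrahom (EmbedInfo K) M ∧ RepresentsAgeOf K M := by
  obtain ⟨S, hS⟩ := K.exists_genericChain hHP hJEP hAP
  have hS : S.Comp := hS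
  exact ⟨S.limit, hS.strComputableIn_limit hL hK.1,
    compUltrahom_of_matched (S.decIn_dom _) hS.decIn_matched fun _ _ hl hc =>
      S.exists_matched hl hc, S.representsAgeOf hHP⟩

end CFL
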